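/- arXiv:2510.19339 — 3 statements merged into one kernel-verified Lean document; each statement's English description precedes it below -/
import Mathlib

section
/- Let d ≥ 1 and let A : ℝ^{d+1} → ℝ^{d×d} be bounded, continuously differentiable, and uniformly elliptic: ⟨A(z)ξ,ξ⟩ ≥ λ|ξ|² for some λ > 0 and all z, ξ. Then for every ε > 0, all i,j,k ∈ {1,…,d} and all x, ζ ∈ ℝ^d, τ < t, the integral defining w̃^{i,j,k}_ε(x,t;ζ,τ) converges absolutely, and the following scaling identities hold: w̃^{i,j,k}_ε(x,t;ζ,τ) = ε^{1−d} w̃^{i,j,k}_1(S^ε(x,t); S^ε(ζ,τ)), and consequently Z_{ε;1}(x,t;ζ,τ) = ε^{−d} Z_{1;1}(S^ε(x,t); S^ε(ζ,τ)); that is, the first parametrix correction Z_{ε;1} obeys the same parabolic scaling relation Z_{ε;1} = ε^{−d} Z_{1;1} ∘ (S^ε ⊗ S^ε) as the frozen-coefficient kernel Z_{ε;0} and as the fundamental solution of the rescaled parabolic operator. -/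
/-!
**Statement 6** (scaling of the first parametrix correction `Z_{ε;1}`).

The auxiliary integrals `w̃^{i,j,k}_ε` and the first parametrix correction
`Z_{ε;1}` are built from the frozen-coefficient kernel `Z_{ε;0}` as in the
paper; second spatial derivatives in the first variable are encoded as iterated
line derivatives, and `∂_k a_{i,j}` as a line derivative of the matrix entries.
-/

open MeasureTheory

noncomputable section

abbrev Pt (d : ℕ) : Type := EuclideanSpace ℝ (Fin d) × ℝ

/-- Parabolic scaling map `S^ε(x,t) = (x/ε, t/ε²)`. -/
def pscale {d : ℕ} (ε : ℝ) (z : Pt d) : Pt d := (ε⁻¹ • z.1, z.2 / ε ^ 2)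

/-- Symmetric part `A_s = (A + Aᵀ)/2` of a matrix. -/
def symPart {d : ℕ} (M : Matrix (Fin d) (Fin d) ℝ) : Matrix (Fin d) (Fin d) ℝ :=
  (2⁻¹ : ℝ) • (M + M.transpose)

/-- `C_ε(x,t) = (4π)^{-d/2} det(A_s(x/ε, t/ε²))^{-1/2}`. -/
noncomputable def Cfun {d : ℕ} (A : Pt d → Matrix (Fin d) (Fin d) ℝ) (ε : ℝ) (z : Pt d) : ℝ :=
  (4 * Real.pi) ^ (-(d : ℝ) / 2) * (symPart (A (pscale ε z))).det ^ (-(1 : ℝ) / 2)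

/-- `ϑ_ε^{(x,t)}(ζ) = Σ_{i,j} (A(x/ε,t/ε²)⁻¹)_{i,j} ζ_i ζ_j`. -/
noncomputable def theta {d : ℕ} (A : Pt d → Matrix (Fin d) (Fin d) ℝ) (ε : ℝ) (z : Pt d)
    (ζ : EuclideanSpace ℝ (Fin d)) : ℝ :=
  ∑ i : Fin d, ∑ j : Fin d, (A (pscale ε z))⁻¹ i j * ζ i * ζ j

/-- `w_ε^z(ζ,τ) = 1_{τ>0} τ^{-d/2} exp(−ϑ_ε^z(ζ)/(4τ))`. -/
noncomputable def wfun {d : ℕ} (A : Pt d → Matrix (Fin d) (Fin d) ℝ) (ε : ℝ) (z : Pt d)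
    (ζ : EuclideanSpace ℝ (Fin d)) (τ : ℝ) : ℝ :=
  if 0 < τ then τ ^ (-(d : ℝ) / 2) * Real.exp (-(theta A ε z ζ) / (4 * τ)) else 0

/-- Frozen-coefficient kernel `Z_{ε;0}(x,t;ζ,τ) = C_ε(ζ,τ) w_ε^{(ζ,τ)}(x−ζ, t−τ)`. -/
noncomputable def Z0 {d : ℕ} (A : Pt d → Matrix (Fin d) (Fin d) ℝ) (ε : ℝ) (z w : Pt d) : ℝ :=
  Cfun A ε w * wfun A ε w (z.1 - w.1) (z.2 - w.2)

/-- Second spatial derivative `∂_{η_i} ∂_{η_j} g` as an iterated line derivative. -/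
noncomputable def sDeriv2 {d : ℕ} (i j : Fin d) (g : EuclideanSpace ℝ (Fin d) → ℝ)
    (η : EuclideanSpace ℝ (Fin d)) : ℝ :=
  lineDeriv ℝ (fun y => lineDeriv ℝ g y (EuclideanSpace.single j 1)) η
    (EuclideanSpace.single i 1)

/-- Integrand of the auxiliary integral `w̃^{i,j,k}_ε(x,t;ζ,τ)` as a function of `(σ,η)`. -/
noncomputable def wTildeInt {d : ℕ} (A : Pt d → Matrix (Fin d) (Fin d) ℝ) (ε : ℝ)
    (i j k : Fin d) (z w : Pt d) (q : ℝ × EuclideanSpace ℝ (Fin d)) : ℝ :=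
  wfun A ε w (z.1 - q.2) (z.2 - q.1) * (q.2 k - w.1 k) *
    sDeriv2 i j (fun y => Z0 A ε (y, q.1) w) q.2

/-- `w̃^{i,j,k}_ε(x,t;ζ,τ) = ∫_τ^t ∫_{ℝ^d} w_ε^{(ζ,τ)}(x−η,t−σ) (η−ζ)_k
    ∂_{η_i}∂_{η_j} Z_{ε;0}(η,σ;ζ,τ) dη dσ`. -/
noncomputable def wTilde {d : ℕ} (A : Pt d → Matrix (Fin d) (Fin d) ℝ) (ε : ℝ)
    (i j k : Fin d) (z w : Pt d) : ℝ :=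
  ∫ σ in Set.Ioo w.2 z.2, ∫ η : EuclideanSpace ℝ (Fin d), wTildeInt A ε i j k z w (σ, η)

/-- First parametrix correction
`Z_{ε;1} = Σ_{k,i,j} ε^{-1} (∂_k a_{i,j})(ζ/ε,τ/ε²) C_ε(ζ,τ) w̃^{i,j,k}_ε`. -/
noncomputable def Z1 {d : ℕ} (A : Pt d → Matrix (Fin d) (Fin d) ℝ) (ε : ℝ) (z w : Pt d) : ℝ :=
  ∑ k : Fin d, ∑ i : Fin d, ∑ j : Fin d,
    ε⁻¹ *
      lineDeriv ℝ (fun p => A p i j) (pscale ε w)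
        ((EuclideanSpace.single k 1 : EuclideanSpace ℝ (Fin d)), (0 : ℝ)) *
      Cfun A ε w * wTilde A ε i j k z w

section QuadraticExponential

variable {E : Type*} [NormedAddCommGroup E] [NormedSpace ℝ E]

lemma hasDerivAt_bilin_add_smul (β : E →L[ℝ] E →L[ℝ] ℝ) (u e : E) :
    HasDerivAt (fun h : ℝ => β (u + h • e) (u + h • e)) (β u e + β e u) 0 := by
  have h1 : (fun h : ℝ => β (u + h • e) (u + h • e)) =
      fun h : ℝ => β u u + h * (β u e + β e u) + h ^ 2 * β e e := by
    ext h
    simp only [map_add, map_smul, add_apply, smul_apply, smul_eq_mul]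
    ring
  rw [h1]
  have h2 := (((hasDerivAt_id (0 : ℝ)).mul_const (β u e + β e u)).const_add (β u u)).add
    (((hasDerivAt_id (0 : ℝ)).pow 2).mul_const (β e e))
  refine h2.congr_deriv ?_
  simp

lemma hasDerivAt_exp_bilin_add_smul (β : E →L[ℝ] E →L[ℝ] ℝ) (K s : ℝ) (u e : E) :
    HasDerivAt (fun h : ℝ => K * Real.exp (-(β (u + h • e) (u + h • e)) / (4 * s)))
      (K * (Real.exp (-(β u u) / (4 * s)) * (-(β u e + β e u) / (4 * s)))) 0 := by
  have h := (((hasDerivAt_bilin_add_smul β u e).neg.div_const (4 * s)).exp).const_mul K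
  simpa using h

lemma lineDeriv_exp_bilin (β : E →L[ℝ] E →L[ℝ] ℝ) (K s : ℝ) (v e y : E) :
    lineDeriv ℝ (fun y => K * Real.exp (-(β (y - v) (y - v)) / (4 * s))) y e =
      K * (Real.exp (-(β (y - v) (y - v)) / (4 * s)) *
        (-(β (y - v) e + β e (y - v)) / (4 * s))) := by
  have h := (hasDerivAt_exp_bilin_add_smul β K s (y - v) e).deriv
  simpa only [lineDeriv, add_sub_right_comm] using h

lemma lineDeriv_lineDeriv_exp_bilin (β : E →L[ℝ] E →L[ℝ] ℝ) (K s : ℝ) (v e e' y : E) :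
    lineDeriv ℝ (fun y => lineDeriv ℝ
        (fun y => K * Real.exp (-(β (y - v) (y - v)) / (4 * s))) y e) y e' =
      K * Real.exp (-(β (y - v) (y - v)) / (4 * s)) *
        ((β (y - v) e + β e (y - v)) * (β (y - v) e' + β e' (y - v)) / (16 * s ^ 2) -
          (β e' e + β e e') / (4 * s)) := by
  simp only [lineDeriv_exp_bilin]
  have hlin : HasDerivAt (fun h : ℝ => -(β (y - v + h • e') e + β e (y - v + h • e')) / (4 * s))
      (-(β e' e + β e e') / (4 * s)) 0 := by
    have h1 : (fun h : ℝ => -(β (y - v + h • e') e + β e (y - v + h • e')) / (4 * s)) =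
        fun h : ℝ => -(β (y - v) e + β e (y - v)) / (4 * s) +
          h * (-(β e' e + β e e') / (4 * s)) := by
      ext h
      simp only [map_add, map_smul, add_apply, smul_apply, smul_eq_mul]
      ring
    rw [h1]
    simpa using ((hasDerivAt_id (0 : ℝ)).mul_const (-(β e' e + β e e') / (4 * s))).const_add
      (-(β (y - v) e + β e (y - v)) / (4 * s))
  have h := ((hasDerivAt_exp_bilin_add_smul β 1 s (y - v) e').mul hlin).const_mul K |>.deriv
  simp only [lineDeriv, add_sub_right_comm]
  simp only [one_mul, Pi.mul_apply, zero_smul, add_zero] at h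
  rw [h]
  ring

end QuadraticExponential

section GaussianBounds

lemma exists_mul_exp_le_rpow_mul_exp {c : ℝ} (hc : 0 < c) :
    ∃ K : ℝ, 0 < K ∧ ∀ s r : ℝ, 0 < s → 0 ≤ r →
      r * (r ^ 2 / s ^ 2 + 1 / s) * Real.exp (-(c * r ^ 2) / (4 * s)) ≤
        K * s ^ (-(1 : ℝ) / 2) * Real.exp (-(c / 8 * r ^ 2 / s)) := by
  refine ⟨(1 + 16 / c) ^ 2, by positivity, fun s r hs hr => ?_⟩
  obtain ⟨u, hu, rfl⟩ : ∃ u : ℝ, 0 < u ∧ s = u ^ 2 :=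
    ⟨√s, Real.sqrt_pos.2 hs, (Real.sq_sqrt hs.le).symm⟩
  have hpow : (u ^ 2 : ℝ) ^ (-(1 : ℝ) / 2) = u⁻¹ := by
    rw [← Real.rpow_natCast, ← Real.rpow_mul hu.le, ← Real.rpow_neg_one]
    norm_num
  obtain ⟨p, rfl⟩ : ∃ p : ℝ, r = u * p := ⟨r / u, by field_simp⟩
  have hp : 0 ≤ p := nonneg_of_mul_nonneg_right hr hu
  have h1 : -(c * (u * p) ^ 2) / (4 * u ^ 2) = -(c / 8 * p ^ 2) + -(c / 8 * p ^ 2) := by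
    field_simp; ring
  have h2 : -(c / 8 * (u * p) ^ 2 / u ^ 2) = -(c / 8 * p ^ 2) := by field_simp
  have h3 : u * p * ((u * p) ^ 2 / (u ^ 2) ^ 2 + 1 / u ^ 2) = u⁻¹ * (p ^ 3 + p) := by field_simp
  rw [hpow, h1, h2, h3, Real.exp_add]
  have h4 : p ^ 3 + p ≤ (1 + p ^ 2) ^ 2 := by
    nlinarith [mul_nonneg hp hp, sq_nonneg (p - 1),
      mul_nonneg (mul_nonneg hp hp) (sq_nonneg (p - 1))]
  have h5 : 1 + p ^ 2 ≤ (1 + 16 / c) * (1 + c / 16 * p ^ 2) := by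
    have : (1 + 16 / c) * (1 + c / 16 * p ^ 2) = 1 + p ^ 2 + (16 / c + c / 16 * p ^ 2) := by
      field_simp; ring
    rw [this]
    have : 0 ≤ 16 / c + c / 16 * p ^ 2 := by positivity
    linarith
  have h6 : 1 + c / 16 * p ^ 2 ≤ Real.exp (c / 16 * p ^ 2) := by
    linarith [Real.add_one_le_exp (c / 16 * p ^ 2)]
  have h7 : p ^ 3 + p ≤ (1 + 16 / c) ^ 2 * Real.exp (c / 8 * p ^ 2) := by
    calc p ^ 3 + p ≤ (1 + p ^ 2) ^ 2 := h4
      _ ≤ ((1 + 16 / c) * Real.exp (c / 16 * p ^ 2)) ^ 2 := by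
        gcongr
        exact h5.trans (by gcongr)
      _ = (1 + 16 / c) ^ 2 * Real.exp (c / 8 * p ^ 2) := by
        rw [mul_pow, ← Real.exp_nat_mul]
        congr 2
        push_cast
        ring
  have h8 : (p ^ 3 + p) * Real.exp (-(c / 8 * p ^ 2)) ≤ (1 + 16 / c) ^ 2 := by
    rw [Real.exp_neg, ← div_eq_mul_inv, div_le_iff₀ (Real.exp_pos _)]
    exact h7
  calc u⁻¹ * (p ^ 3 + p) * (Real.exp (-(c / 8 * p ^ 2)) * Real.exp (-(c / 8 * p ^ 2)))
      = (p ^ 3 + p) * Real.exp (-(c / 8 * p ^ 2)) * (u⁻¹ * Real.exp (-(c / 8 * p ^ 2))) := by ring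
    _ ≤ (1 + 16 / c) ^ 2 * (u⁻¹ * Real.exp (-(c / 8 * p ^ 2))) := by gcongr
    _ = _ := by ring

lemma mul_rpow_mul_le_add {a s s' g g' : ℝ} (ha : a ≤ 0) (hs : 0 < s) (hs' : 0 < s')
    (hg : 0 ≤ g) (hg1 : g ≤ 1) (hg' : 0 ≤ g') (hg1' : g' ≤ 1) :
    s ^ a * g * (s' ^ a * g') ≤ ((s + s') / 2) ^ a * (s ^ a * g + s' ^ a * g') := by
  have hX : 0 ≤ s ^ a * g := by positivity
  have hX' : 0 ≤ s' ^ a * g' := by positivity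
  have hP : 0 ≤ ((s + s') / 2) ^ a := by positivity
  rcases le_total s s' with h | h
  · have h1 : s' ^ a ≤ ((s + s') / 2) ^ a :=
      Real.rpow_le_rpow_of_nonpos (by positivity) (by linarith) ha
    have h2 : s' ^ a * g' ≤ ((s + s') / 2) ^ a :=
      (mul_le_of_le_one_right (by positivity) hg1').trans h1
    nlinarith [mul_le_mul_of_nonneg_left h2 hX, mul_nonneg hP hX']
  · have h1 : s ^ a ≤ ((s + s') / 2) ^ a :=
      Real.rpow_le_rpow_of_nonpos (by positivity) (by linarith) ha
    have h2 : s ^ a * g ≤ ((s + s') / 2) ^ a :=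
      (mul_le_of_le_one_right (by positivity) hg1).trans h1
    nlinarith [mul_le_mul_of_nonneg_right h2 hX', mul_nonneg hP hX]

variable {d : ℕ}

lemma integral_gaussian_heat {c s : ℝ} (hc : 0 < c) (hs : 0 < s)
    (v : EuclideanSpace ℝ (Fin d)) :
    ∫ η : EuclideanSpace ℝ (Fin d), s ^ (-(d : ℝ) / 2) * Real.exp (-(c * ‖η - v‖ ^ 2 / s)) =
      (Real.pi / c) ^ ((d : ℝ) / 2) := by
  rw [integral_const_mul,
    integral_sub_right_eq_self (fun η => Real.exp (-(c * ‖η‖ ^ 2 / s))) v]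
  have h := GaussianFourier.integral_rexp_neg_mul_sq_norm (V := EuclideanSpace ℝ (Fin d))
    (b := c / s) (by positivity)
  rw [finrank_euclideanSpace_fin] at h
  have h1 : (fun η : EuclideanSpace ℝ (Fin d) => Real.exp (-(c * ‖η‖ ^ 2 / s))) =
      fun η => Real.exp (-(c / s) * ‖η‖ ^ 2) := by
    ext η; congr 1; ring
  rw [h1, h, neg_div, Real.rpow_neg hs.le, ← Real.inv_rpow hs.le,
    ← Real.mul_rpow (by positivity) (by positivity)]
  congr 1
  field_simp

lemma integrableOn_mul_gaussian_heat {c : ℝ} (hc : 0 < c) {S : Set ℝ} (hS : MeasurableSet S)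
    {f g : ℝ → ℝ} (hf : IntegrableOn f S) (hfm : Measurable f) (hgm : Measurable g)
    (hg : ∀ σ ∈ S, 0 < g σ) (v : EuclideanSpace ℝ (Fin d)) :
    IntegrableOn (fun q : ℝ × EuclideanSpace ℝ (Fin d) =>
      f q.1 * ((g q.1) ^ (-(d : ℝ) / 2) * Real.exp (-(c * ‖q.2 - v‖ ^ 2 / g q.1))))
      (S ×ˢ Set.univ) := by
  rw [IntegrableOn, Measure.volume_eq_prod, ← Measure.prod_restrict, Measure.restrict_univ,
    integrable_prod_iff (by
      refine Measurable.aestronglyMeasurable ?_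
      fun_prop)]
  have hpos : ∀ s, 0 < s → Integrable (fun η : EuclideanSpace ℝ (Fin d) =>
      s ^ (-(d : ℝ) / 2) * Real.exp (-(c * ‖η - v‖ ^ 2 / s))) := fun s hs =>
    Integrable.of_integral_ne_zero (by rw [integral_gaussian_heat hc hs]; positivity)
  refine ⟨?_, ?_⟩
  · filter_upwards [ae_restrict_mem hS] with σ hσ
    exact (hpos _ (hg σ hσ)).const_mul _
  · refine (hf.norm.mul_const ((Real.pi / c) ^ ((d : ℝ) / 2))).congr ?_
    filter_upwards [ae_restrict_mem hS] with σ hσ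
    have hgσ := hg σ hσ
    simp only [norm_mul]
    rw [integral_const_mul, ← integral_gaussian_heat hc hgσ v]
    congr 2
    ext η
    rw [Real.norm_of_nonneg (by positivity), Real.norm_of_nonneg (by positivity)]

end GaussianBounds

section FrozenCoefficients

variable {d : ℕ}

/-- The bilinear form `(u, v) ↦ Σ_{i,j} B_{i,j} u_i v_j` on Euclidean space. -/
noncomputable def matrixBilin (B : Matrix (Fin d) (Fin d) ℝ) :
    EuclideanSpace ℝ (Fin d) →L[ℝ] EuclideanSpace ℝ (Fin d) →L[ℝ] ℝ :=
  LinearMap.toContinuousBilinearMap <|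
    LinearMap.mk₂ ℝ (fun u v => ∑ i, ∑ j, B i j * u i * v j)
      (fun u u' v => by simp [mul_add, add_mul, Finset.sum_add_distrib])
      (fun a u v => by
        simp only [PiLp.smul_apply, smul_eq_mul, Finset.mul_sum]
        exact Finset.sum_congr rfl fun _ _ => Finset.sum_congr rfl fun _ _ => by ring)
      (fun u v v' => by simp [mul_add, Finset.sum_add_distrib])
      (fun a u v => by
        simp only [PiLp.smul_apply, smul_eq_mul, Finset.mul_sum]
        exact Finset.sum_congr rfl fun _ _ => Finset.sum_congr rfl fun _ _ => by ring)

lemma theta_eq_matrixBilin (A : Pt d → Matrix (Fin d) (Fin d) ℝ) (ε : ℝ) (z : Pt d)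
    (v : EuclideanSpace ℝ (Fin d)) :
    theta A ε z v = matrixBilin (A (pscale ε z))⁻¹ v v := rfl

lemma exists_le_matrixBilin_inv {B : Matrix (Fin d) (Fin d) ℝ} {lam : ℝ} (hlam : 0 < lam)
    (hB : ∀ ξ : Fin d → ℝ, lam * ∑ i, ξ i ^ 2 ≤ ∑ i, B.mulVec ξ i * ξ i) :
    ∃ c : ℝ, 0 < c ∧ ∀ v, c * ‖v‖ ^ 2 ≤ matrixBilin B⁻¹ v v := by
  have hinj : Function.Injective B.mulVec := by
    refine (injective_iff_map_eq_zero B.mulVecLin).2 fun ξ hξ => ?_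
    have h := hB ξ
    rw [Matrix.mulVecLin_apply] at hξ
    simp only [hξ, Pi.zero_apply, zero_mul, Finset.sum_const_zero] at h
    have h0 : ∑ i, ξ i ^ 2 = 0 :=
      le_antisymm (nonpos_of_mul_nonpos_right h hlam) (Finset.sum_nonneg fun _ _ => sq_nonneg _)
    ext i
    simpa using (Finset.sum_eq_zero_iff_of_nonneg fun _ _ => sq_nonneg _).1 h0 i (Finset.mem_univ i)
  have hunit : IsUnit B := Matrix.mulVec_injective_iff_isUnit.1 hinj
  have hdet : IsUnit B.det := (Matrix.isUnit_iff_isUnit_det B).1 hunit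
  set N : ℝ := ∑ i, ∑ j, B i j ^ 2 with hN
  have hN0 : 0 ≤ N := Finset.sum_nonneg fun _ _ => Finset.sum_nonneg fun _ _ => sq_nonneg _
  refine ⟨lam / (1 + N), by positivity, fun v => ?_⟩
  set ξ : Fin d → ℝ := B⁻¹.mulVec v with hξ
  have hv : ∀ i, v i = B.mulVec ξ i := fun i => by
    rw [hξ, Matrix.mulVec_mulVec, Matrix.mul_nonsing_inv _ hdet, Matrix.one_mulVec]
  have hform : matrixBilin B⁻¹ v v = ∑ i, B.mulVec ξ i * ξ i := by
    change ∑ i, ∑ j, B⁻¹ i j * v i * v j = _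
    refine Finset.sum_congr rfl fun i _ => ?_
    rw [← hv i, hξ, Matrix.mulVec, dotProduct, Finset.mul_sum]
    exact Finset.sum_congr rfl fun _ _ => by ring
  have hnorm : ‖v‖ ^ 2 ≤ N * ∑ i, ξ i ^ 2 := by
    rw [EuclideanSpace.real_norm_sq_eq, hN, Finset.sum_mul]
    refine Finset.sum_le_sum fun i _ => ?_
    rw [hv i]
    exact Finset.sum_mul_sq_le_sq_mul_sq Finset.univ (B i) ξ
  have hξ0 : 0 ≤ ∑ i, ξ i ^ 2 := Finset.sum_nonneg fun _ _ => sq_nonneg _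
  rw [hform]
  refine le_trans ?_ (hB ξ)
  rw [div_mul_eq_mul_div, div_le_iff₀ (by positivity), mul_assoc]
  gcongr
  nlinarith

lemma Z0_of_lt (A : Pt d → Matrix (Fin d) (Fin d) ℝ) (ε : ℝ) (w : Pt d) {σ : ℝ} (hσ : w.2 < σ) :
    (fun y => Z0 A ε (y, σ) w) = fun y =>
      Cfun A ε w * (σ - w.2) ^ (-(d : ℝ) / 2) *
        Real.exp (-(matrixBilin (A (pscale ε w))⁻¹ (y - w.1) (y - w.1)) / (4 * (σ - w.2))) := by
  ext y
  simp only [Z0, wfun, sub_pos, hσ, if_true, theta_eq_matrixBilin, mul_assoc]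

/-- The integrand of `w̃^{i,j,k}_ε` with its derivatives carried out. -/
lemma wTildeInt_eq (A : Pt d → Matrix (Fin d) (Fin d) ℝ) (ε : ℝ) (i j k : Fin d) (z w : Pt d)
    {q : ℝ × EuclideanSpace ℝ (Fin d)} (hq : w.2 < q.1) (hq' : q.1 < z.2) :
    wTildeInt A ε i j k z w q =
      (let β := matrixBilin (A (pscale ε w))⁻¹
      let ei : EuclideanSpace ℝ (Fin d) := EuclideanSpace.single i 1
      let ej : EuclideanSpace ℝ (Fin d) := EuclideanSpace.single j 1
      (z.2 - q.1) ^ (-(d : ℝ) / 2) *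
          Real.exp (-(β (z.1 - q.2) (z.1 - q.2)) / (4 * (z.2 - q.1))) * (q.2 k - w.1 k) *
        (Cfun A ε w * (q.1 - w.2) ^ (-(d : ℝ) / 2) *
          Real.exp (-(β (q.2 - w.1) (q.2 - w.1)) / (4 * (q.1 - w.2))) *
        ((β (q.2 - w.1) ej + β ej (q.2 - w.1)) * (β (q.2 - w.1) ei + β ei (q.2 - w.1)) /
            (16 * (q.1 - w.2) ^ 2) - (β ei ej + β ej ei) / (4 * (q.1 - w.2))))) := by
  rw [wTildeInt, sDeriv2, Z0_of_lt A ε w hq, lineDeriv_lineDeriv_exp_bilin, wfun,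
    if_pos (sub_pos.2 hq'), theta_eq_matrixBilin]

lemma abs_second_deriv_factor_le {E : Type*} [NormedAddCommGroup E] [NormedSpace ℝ E]
    (β : E →L[ℝ] E →L[ℝ] ℝ) {e e' : E} (he : ‖e‖ = 1) (he' : ‖e'‖ = 1) (u : E) {s : ℝ}
    (hs : 0 < s) :
    |(β u e + β e u) * (β u e' + β e' u) / (16 * s ^ 2) - (β e' e + β e e') / (4 * s)| ≤
      (‖β‖ ^ 2 + ‖β‖) * (‖u‖ ^ 2 / s ^ 2 + 1 / s) := by
  have hb : ∀ x y : E, |β x y| ≤ ‖β‖ * ‖x‖ * ‖y‖ := fun x y => β.le_opNorm₂ x y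
  have hsum : ∀ e : E, ‖e‖ = 1 → |β u e + β e u| ≤ 2 * ‖β‖ * ‖u‖ := fun e he => by
    refine (abs_add_le _ _).trans ?_
    have h1 := hb u e
    have h2 := hb e u
    rw [he] at h1 h2
    linarith
  have hee : |β e' e + β e e'| ≤ 2 * ‖β‖ := by
    refine (abs_add_le _ _).trans ?_
    have h1 := hb e' e
    have h2 := hb e e'
    rw [he, he'] at h1 h2
    linarith
  refine (abs_sub _ _).trans ?_
  rw [abs_div, abs_div, abs_mul, abs_of_pos (show 0 < 16 * s ^ 2 by positivity),
    abs_of_pos (show 0 < 4 * s by positivity)]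
  have h1 : |β u e + β e u| * |β u e' + β e' u| / (16 * s ^ 2) ≤ ‖β‖ ^ 2 * (‖u‖ ^ 2 / s ^ 2) := by
    calc _ ≤ (2 * ‖β‖ * ‖u‖) * (2 * ‖β‖ * ‖u‖) / (16 * s ^ 2) := by
          gcongr
          · exact hsum e he
          · exact hsum e' he'
      _ = ‖β‖ ^ 2 * (‖u‖ ^ 2 / s ^ 2) / 4 := by field_simp; ring
      _ ≤ _ := div_le_self (by positivity) (by norm_num)
  have h2 : |β e' e + β e e'| / (4 * s) ≤ ‖β‖ * (1 / s) := by
    calc _ ≤ 2 * ‖β‖ / (4 * s) := by gcongr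
      _ = ‖β‖ * (1 / s) / 2 := by field_simp; ring
      _ ≤ _ := div_le_self (by positivity) (by norm_num)
  have h3 : 0 ≤ ‖β‖ ^ 2 * (1 / s) := by positivity
  have h4 : 0 ≤ ‖β‖ * (‖u‖ ^ 2 / s ^ 2) := by positivity
  nlinarith

lemma exists_abs_wTildeInt_le (A : Pt d → Matrix (Fin d) (Fin d) ℝ) (ε : ℝ) (i j k : Fin d)
    (z w : Pt d) {c : ℝ} (hc : 0 < c)
    (hβ : ∀ v, c * ‖v‖ ^ 2 ≤ matrixBilin (A (pscale ε w))⁻¹ v v) :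
    ∃ K : ℝ, ∀ q : ℝ × EuclideanSpace ℝ (Fin d), w.2 < q.1 → q.1 < z.2 →
      |wTildeInt A ε i j k z w q| ≤ K *
        ((q.1 - w.2) ^ (-(1 : ℝ) / 2) *
            ((q.1 - w.2) ^ (-(d : ℝ) / 2) *
              Real.exp (-(c / 8 * ‖q.2 - w.1‖ ^ 2 / (q.1 - w.2)))) +
          (q.1 - w.2) ^ (-(1 : ℝ) / 2) *
            ((z.2 - q.1) ^ (-(d : ℝ) / 2) *
              Real.exp (-(c / 8 * ‖q.2 - z.1‖ ^ 2 / (z.2 - q.1))))) := by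
  obtain ⟨K, hK, hKbd⟩ := exists_mul_exp_le_rpow_mul_exp hc
  set β := matrixBilin (A (pscale ε w))⁻¹ with hβdef
  refine ⟨|Cfun A ε w| * (‖β‖ ^ 2 + ‖β‖) * K * ((z.2 - w.2) / 2) ^ (-(d : ℝ) / 2),
    fun q hq hq' => ?_⟩
  rw [wTildeInt_eq A ε i j k z w hq hq']
  simp only [← hβdef]
  set s := q.1 - w.2 with hs_def
  set s' := z.2 - q.1 with hs'_def
  have hs : 0 < s := sub_pos.2 hq
  have hs' : 0 < s' := sub_pos.2 hq'
  have hT : z.2 - w.2 = s + s' := by rw [hs_def, hs'_def]; ring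
  set u := q.2 - w.1 with hu
  have hcoord : |q.2 k - w.1 k| ≤ ‖u‖ := by
    simpa [hu] using PiLp.norm_apply_le u k
  have hfac := abs_second_deriv_factor_le β (e := EuclideanSpace.single j (1 : ℝ))
    (e' := EuclideanSpace.single i (1 : ℝ)) (by simp) (by simp) u hs
  have hexp' : Real.exp (-(β (z.1 - q.2) (z.1 - q.2)) / (4 * s')) ≤
      Real.exp (-(c / 8 * ‖q.2 - z.1‖ ^ 2 / s')) := by
    rw [Real.exp_le_exp, neg_div, neg_le_neg_iff, div_le_div_iff₀ hs' (by positivity),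
      norm_sub_rev]
    have h1 := hβ (z.1 - q.2)
    have h2 : 0 ≤ c * ‖z.1 - q.2‖ ^ 2 * s' := by positivity
    nlinarith [mul_le_mul_of_nonneg_right h1 hs'.le]
  have hexp : Real.exp (-(β u u) / (4 * s)) ≤ Real.exp (-(c * ‖u‖ ^ 2) / (4 * s)) := by
    gcongr
    exact hβ u
  have hmain := hKbd s ‖u‖ hs (norm_nonneg u)
  have hle1 : ∀ (v : EuclideanSpace ℝ (Fin d)) (r : ℝ), 0 < r →
      Real.exp (-(c / 8 * ‖v‖ ^ 2 / r)) ≤ 1 := fun v r hr =>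
    Real.exp_le_one_iff.2 (neg_nonpos.2 (by positivity))
  have hprod := mul_rpow_mul_le_add (a := -(d : ℝ) / 2)
    (div_nonpos_of_nonpos_of_nonneg (by simp) (by norm_num)) hs hs'
    (Real.exp_pos _).le (hle1 u s hs) (Real.exp_pos _).le (hle1 (q.2 - z.1) s' hs')
  rw [abs_mul, abs_mul, abs_mul, abs_mul, abs_mul, abs_mul, Real.abs_exp, Real.abs_exp,
    abs_of_nonneg (show 0 ≤ s ^ (-(d : ℝ) / 2) by positivity),
    abs_of_nonneg (show 0 ≤ s' ^ (-(d : ℝ) / 2) by positivity), hT]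
  calc _ ≤ s' ^ (-(d : ℝ) / 2) * Real.exp (-(c / 8 * ‖q.2 - z.1‖ ^ 2 / s')) * ‖u‖ *
        (|Cfun A ε w| * s ^ (-(d : ℝ) / 2) * Real.exp (-(c * ‖u‖ ^ 2) / (4 * s)) *
          ((‖β‖ ^ 2 + ‖β‖) * (‖u‖ ^ 2 / s ^ 2 + 1 / s))) := by gcongr
    _ = |Cfun A ε w| * (‖β‖ ^ 2 + ‖β‖) * (s ^ (-(d : ℝ) / 2) *
        (s' ^ (-(d : ℝ) / 2) * Real.exp (-(c / 8 * ‖q.2 - z.1‖ ^ 2 / s')))) *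
        (‖u‖ * (‖u‖ ^ 2 / s ^ 2 + 1 / s) * Real.exp (-(c * ‖u‖ ^ 2) / (4 * s))) := by ring
    _ ≤ |Cfun A ε w| * (‖β‖ ^ 2 + ‖β‖) * (s ^ (-(d : ℝ) / 2) *
        (s' ^ (-(d : ℝ) / 2) * Real.exp (-(c / 8 * ‖q.2 - z.1‖ ^ 2 / s')))) *
        (K * s ^ (-(1 : ℝ) / 2) * Real.exp (-(c / 8 * ‖u‖ ^ 2 / s))) := by gcongr
    _ = |Cfun A ε w| * (‖β‖ ^ 2 + ‖β‖) * K * s ^ (-(1 : ℝ) / 2) *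
        (s ^ (-(d : ℝ) / 2) * Real.exp (-(c / 8 * ‖u‖ ^ 2 / s)) *
        (s' ^ (-(d : ℝ) / 2) * Real.exp (-(c / 8 * ‖q.2 - z.1‖ ^ 2 / s')))) := by ring
    _ ≤ |Cfun A ε w| * (‖β‖ ^ 2 + ‖β‖) * K * s ^ (-(1 : ℝ) / 2) *
        (((s + s') / 2) ^ (-(d : ℝ) / 2) *
        (s ^ (-(d : ℝ) / 2) * Real.exp (-(c / 8 * ‖u‖ ^ 2 / s)) +
        s' ^ (-(d : ℝ) / 2) * Real.exp (-(c / 8 * ‖q.2 - z.1‖ ^ 2 / s')))) := by gcongr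
    _ = _ := by ring

lemma integrableOn_sub_rpow (a b : ℝ) {r : ℝ} (hr : -1 < r) (hab : a < b) :
    IntegrableOn (fun σ : ℝ => (σ - a) ^ r) (Set.Ioo a b) := by
  have h := (intervalIntegral.intervalIntegrable_rpow' (a := 0) (b := b - a) hr).comp_sub_right a
  simp only [zero_add, sub_add_cancel] at h
  exact (intervalIntegrable_iff_integrableOn_Ioo_of_le hab.le).1 h

lemma integrableOn_wTildeInt (A : Pt d → Matrix (Fin d) (Fin d) ℝ) (ε : ℝ) (i j k : Fin d)
    (z w : Pt d) (hzw : w.2 < z.2) {lam : ℝ} (hlam : 0 < lam)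
    (hell : ∀ ξ : Fin d → ℝ,
      lam * ∑ i, ξ i ^ 2 ≤ ∑ i, (A (pscale ε w)).mulVec ξ i * ξ i) :
    IntegrableOn (wTildeInt A ε i j k z w) (Set.Ioo w.2 z.2 ×ˢ Set.univ) := by
  obtain ⟨c, hc, hβ⟩ := exists_le_matrixBilin_inv hlam hell
  obtain ⟨K, hK⟩ := exists_abs_wTildeInt_le A ε i j k z w hc hβ
  have hS : MeasurableSet (Set.Ioo w.2 z.2 ×ˢ (Set.univ : Set (EuclideanSpace ℝ (Fin d)))) :=
    measurableSet_Ioo.prod MeasurableSet.univ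
  have hrpow := integrableOn_sub_rpow w.2 z.2 (r := -(1 : ℝ) / 2) (by norm_num) hzw
  have hdom := ((integrableOn_mul_gaussian_heat (c := c / 8) (by positivity) measurableSet_Ioo
      hrpow (by fun_prop) (g := fun σ => σ - w.2) (by fun_prop) (fun σ hσ => sub_pos.2 hσ.1)
      w.1).add
    (integrableOn_mul_gaussian_heat (c := c / 8) (by positivity) measurableSet_Ioo
      hrpow (by fun_prop) (g := fun σ => z.2 - σ) (by fun_prop) (fun σ hσ => sub_pos.2 hσ.2)
      z.1)).const_mul K
  refine Integrable.mono' hdom ?_ ?_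
  · refine AEStronglyMeasurable.congr (Measurable.aestronglyMeasurable ?_)
      ((ae_restrict_mem hS).mono fun q hq => (wTildeInt_eq A ε i j k z w hq.1.1 hq.1.2).symm)
    dsimp only
    fun_prop
  · filter_upwards [ae_restrict_mem hS] with q hq
    exact hK q hq.1.1 hq.1.2

end FrozenCoefficients

section Scaling

variable {d : ℕ}

@[simp]
lemma pscale_one (z : Pt d) : pscale 1 z = z := by simp [pscale]

lemma Cfun_pscale (A : Pt d → Matrix (Fin d) (Fin d) ℝ) (ε : ℝ) (w : Pt d) :
    Cfun A 1 (pscale ε w) = Cfun A ε w := by simp [Cfun]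

lemma theta_pscale (A : Pt d → Matrix (Fin d) (Fin d) ℝ) (ε : ℝ) (w : Pt d)
    (v : EuclideanSpace ℝ (Fin d)) :
    theta A 1 (pscale ε w) (ε⁻¹ • v) = (ε ^ 2)⁻¹ * theta A ε w v := by
  simp only [theta_eq_matrixBilin, pscale_one, map_smul, smul_apply, smul_eq_mul]
  ring

lemma wfun_scaling (A : Pt d → Matrix (Fin d) (Fin d) ℝ) {ε : ℝ} (hε : 0 < ε) (w : Pt d)
    (v : EuclideanSpace ℝ (Fin d)) (s : ℝ) :
    wfun A ε w v s = (ε ^ d)⁻¹ * wfun A 1 (pscale ε w) (ε⁻¹ • v) (s / ε ^ 2) := by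
  by_cases hs : 0 < s
  · have hpow : (ε ^ 2 : ℝ) ^ (-(d : ℝ) / 2) = (ε ^ d)⁻¹ := by
      rw [← Real.rpow_natCast ε 2, ← Real.rpow_mul hε.le, ← Real.rpow_natCast ε d,
        ← Real.rpow_neg hε.le]
      congr 1
      push_cast
      ring
    have harg : -((ε ^ 2)⁻¹ * theta A ε w v) / (4 * (s / ε ^ 2)) = -theta A ε w v / (4 * s) := by
      field_simp
    rw [wfun, wfun, if_pos hs, if_pos (by positivity), theta_pscale, harg,
      Real.div_rpow hs.le (by positivity), hpow]
    field_simp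
  · have hs' : ¬ 0 < s / ε ^ 2 := fun h => hs (by
      have := mul_pos h (pow_pos hε 2)
      rwa [div_mul_cancel₀ _ (by positivity)] at this)
    rw [wfun, wfun, if_neg hs, if_neg hs', mul_zero]

lemma Z0_scaling (A : Pt d → Matrix (Fin d) (Fin d) ℝ) {ε : ℝ} (hε : 0 < ε) (z w : Pt d) :
    Z0 A ε z w = (ε ^ d)⁻¹ * Z0 A 1 (pscale ε z) (pscale ε w) := by
  rw [Z0, Z0, Cfun_pscale, wfun_scaling A hε]
  simp only [pscale, smul_sub, sub_div]
  ring

lemma lineDeriv_const_mul_comp_smul {E : Type*} [AddCommGroup E] [Module ℝ E] (f : E → ℝ)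
    (a r : ℝ) (y v : E) :
    lineDeriv ℝ (fun y => a * f (r • y)) y v = a * (r * lineDeriv ℝ f (r • y) v) := by
  have h := deriv_comp_mul_left r (fun h : ℝ => f (r • y + h • v)) 0
  simp only [mul_zero, smul_eq_mul] at h
  simp only [lineDeriv, smul_add, smul_smul, deriv_const_mul_field]
  rw [← h]

lemma sDeriv2_const_mul_comp_smul (i j : Fin d) (f : EuclideanSpace ℝ (Fin d) → ℝ) (a r : ℝ)
    (y : EuclideanSpace ℝ (Fin d)) :
    sDeriv2 i j (fun y => a * f (r • y)) y = a * r ^ 2 * sDeriv2 i j f (r • y) := by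
  simp only [sDeriv2, lineDeriv_const_mul_comp_smul, ← mul_assoc]
  rw [lineDeriv_const_mul_comp_smul
    (fun y => lineDeriv ℝ f y (EuclideanSpace.single j 1)) (a * r) r y]
  ring

lemma wTildeInt_scaling (A : Pt d → Matrix (Fin d) (Fin d) ℝ) {ε : ℝ} (hε : 0 < ε)
    (i j k : Fin d) (z w : Pt d) (σ : ℝ) (η : EuclideanSpace ℝ (Fin d)) :
    wTildeInt A ε i j k z w (σ, η) = (ε ^ d)⁻¹ * (ε ^ d)⁻¹ * ε⁻¹ *
      wTildeInt A 1 i j k (pscale ε z) (pscale ε w) ((ε ^ 2)⁻¹ • σ, ε⁻¹ • η) := by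
  have hZ : (fun y => Z0 A ε (y, σ) w) = fun y =>
      (ε ^ d)⁻¹ * (fun y => Z0 A 1 (y, (ε ^ 2)⁻¹ • σ) (pscale ε w)) (ε⁻¹ • y) := by
    ext y
    rw [Z0_scaling A hε]
    simp only [pscale, smul_eq_mul, div_eq_inv_mul]
  rw [wTildeInt, wTildeInt, hZ, sDeriv2_const_mul_comp_smul i j
    (fun y => Z0 A 1 (y, (ε ^ 2)⁻¹ • σ) (pscale ε w)), wfun_scaling A hε]
  simp only [pscale, smul_sub, PiLp.smul_apply, smul_eq_mul, div_eq_inv_mul]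
  field_simp

open scoped Pointwise in
lemma wTilde_scaling (A : Pt d → Matrix (Fin d) (Fin d) ℝ) {ε : ℝ} (hε : 0 < ε)
    (i j k : Fin d) (z w : Pt d) :
    wTilde A ε i j k z w =
      ε ^ ((1 : ℤ) - d) * wTilde A 1 i j k (pscale ε z) (pscale ε w) := by
  let F := fun (σ : ℝ) (η : EuclideanSpace ℝ (Fin d)) =>
    wTildeInt A 1 i j k (pscale ε z) (pscale ε w) (σ, η)
  have hinner : ∀ σ, ∫ η, wTildeInt A ε i j k z w (σ, η) =
      (ε ^ d)⁻¹ * ε⁻¹ * ∫ η, F ((ε ^ 2)⁻¹ • σ) η := fun σ => by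
    simp only [wTildeInt_scaling A hε]
    rw [integral_const_mul]
    rw [Measure.integral_comp_smul volume (fun η => F ((ε ^ 2)⁻¹ • σ) η) ε⁻¹,
      finrank_euclideanSpace_fin, abs_of_pos (by positivity), smul_eq_mul, inv_pow, inv_inv]
    field_simp
  have hIoo : (ε ^ 2)⁻¹ • Set.Ioo w.2 z.2 = Set.Ioo (pscale ε w).2 (pscale ε z).2 := by
    rw [LinearOrderedField.smul_Ioo (by positivity)]
    simp only [pscale, div_eq_inv_mul]
  rw [wTilde, wTilde]
  simp only [hinner]
  rw [integral_const_mul, Measure.setIntegral_comp_smul_of_pos volume (fun σ => ∫ η, F σ η) _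
    (by positivity), hIoo, Module.finrank_self, smul_eq_mul, zpow_sub₀ hε.ne']
  simp only [zpow_one, zpow_natCast]
  field_simp
  rfl

lemma Z1_scaling (A : Pt d → Matrix (Fin d) (Fin d) ℝ) {ε : ℝ} (hε : 0 < ε) (z w : Pt d) :
    Z1 A ε z w = (ε ^ d)⁻¹ * Z1 A 1 (pscale ε z) (pscale ε w) := by
  simp only [Z1, Finset.mul_sum, wTilde_scaling A hε, pscale_one, Cfun_pscale]
  refine Finset.sum_congr rfl fun k _ => Finset.sum_congr rfl fun i _ =>
    Finset.sum_congr rfl fun j _ => ?_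
  rw [zpow_sub₀ hε.ne']
  simp only [zpow_one, zpow_natCast]
  field_simp

end Scaling

theorem stmt6 (d : ℕ) (hd : 1 ≤ d) (A : Pt d → Matrix (Fin d) (Fin d) ℝ) (M lam : ℝ)
    -- `A` is bounded ...
    (hbdd : ∀ z i j, |A z i j| ≤ M)
    -- ... continuously differentiable ...
    (hC1 : ∀ i j, ContDiff ℝ 1 fun z : Pt d => A z i j)
    -- ... and uniformly elliptic: `⟨A(z)ξ, ξ⟩ ≥ λ|ξ|²`
    (hlam : 0 < lam)
    (hell : ∀ (z : Pt d) (ξ : Fin d → ℝ),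
      lam * ∑ i, ξ i ^ 2 ≤ ∑ i, (A z).mulVec ξ i * ξ i) :
    ∀ ε : ℝ, 0 < ε → ∀ (i j k : Fin d) (z w : Pt d), w.2 < z.2 →
      -- the integral defining `w̃^{i,j,k}_ε` converges absolutely ...
      IntegrableOn (wTildeInt A ε i j k z w) (Set.Ioo w.2 z.2 ×ˢ Set.univ) ∧
      -- ... and the scaling identities hold:
      wTilde A ε i j k z w = ε ^ ((1 : ℤ) - d) * wTilde A 1 i j k (pscale ε z) (pscale ε w) ∧
      Z1 A ε z w = (ε ^ d)⁻¹ * Z1 A 1 (pscale ε z) (pscale ε w) := by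
  intro ε hε i j k z w hzw
  exact ⟨integrableOn_wTildeInt A ε i j k z w hzw hlam (hell _), wTilde_scaling A hε i j k z w,
    Z1_scaling A hε z w⟩
end
end

section
/- Let d ≥ 1 and κ ∈ (0,1). There exists C = C(d,κ) such that the following holds for every ε ∈ (0,1]. Let f : ℝ^{d+1} → ℝ be bounded and measurable, periodic with respect to (εℤ)^d × (ε²ℤ) (i.e. f(x+εk, t+ε²m) = f(x,t) for all k ∈ ℤ^d, m ∈ ℤ), and with vanishing mean over the periodicity cell, ∫_{[0,ε]^d×[0,ε²]} f = 0. Then for every λ ∈ (0,1], every z₀ ∈ ℝ^{d+1}, and every φ : ℝ^{d+1} → ℝ supported in the parabolic ball {z : |z|_s ≤ 1} with sup|φ| ≤ 1 and sup_{z≠z̄} |φ(z)−φ(z̄)|/|z−z̄|_s^κ ≤ 1, one has |∫_{ℝ^{d+1}} f(z) φ^λ_{z₀}(z) dz| ≤ C ε^κ λ^{−κ} sup|f|. (This is the case p = ∞ of Lemma A.1: a bounded mean-zero function oscillating at parabolic scale ε has parabolic Hölder–Besov norm of order −κ of size at most C ε^κ ‖f‖_{L^∞}.) -/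
/-!
**Statement 8** (oscillation estimate, Lemma A.1 with p = ∞).

A bounded, measurable, `(εℤ)^d × (ε²ℤ)`-periodic function with vanishing mean
over the periodicity cell, tested against a parabolically rescaled test
function of Hölder class `C_s^κ` supported in the parabolic unit ball, gives a
contribution of size at most `C ε^κ λ^{-κ} sup|f|`.
-/

open MeasureTheory

noncomputable section

/-- Parabolic distance `|z - w|_s = |x - x̄| + |t - t̄|^{1/2}`. -/
def pdist {d : ℕ} (z w : Pt d) : ℝ := ‖z.1 - w.1‖ + Real.sqrt |z.2 - w.2|

/-- The periodicity cell `[0,ε]^d × [0,ε²]`. -/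
def cellSet (d : ℕ) (ε : ℝ) : Set (Pt d) :=
  {z : Pt d | (∀ i, z.1 i ∈ Set.Icc 0 ε) ∧ z.2 ∈ Set.Icc 0 (ε ^ 2)}

section FundamentalDomain

variable {ι E : Type*} [NormedAddCommGroup E] [NormedSpace ℝ E] (b : Module.Basis ι ℝ E)

/-- A function invariant under the vectors of a basis is invariant under the lattice they span. -/
lemma apply_vadd_span_eq {F : Type*} {f : E → F} (hf : ∀ i z, f (z + b i) = f z)
    (g : Submodule.span ℤ (Set.range b)) (z : E) : f (g +ᵥ z) = f z := by
  obtain ⟨g, hg⟩ := g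
  change f (g + z) = f z
  induction hg using Submodule.span_induction generalizing z with
  | mem x hx =>
    obtain ⟨i, rfl⟩ := hx
    rw [add_comm, hf]
  | zero => simp
  | add x y _ _ ihx ihy => rw [add_assoc, ihx, ihy]
  | smul n x _ ih =>
    induction n with
    | zero => simp
    | succ n ihn => rw [add_smul, one_smul, add_comm (_ • x), add_assoc, ih, ihn]
    | pred n ihn => rw [sub_smul, one_smul, ← ih, ← add_assoc, add_sub_cancel, ihn]

variable [Finite ι] [MeasurableSpace E] [BorelSpace E]

open scoped Pointwise in
/-- The integral of a periodic function over a translated fundamental domain. -/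
lemma setIntegral_fundamentalDomain_add {μ : Measure E} [μ.IsAddHaarMeasure]
    {f : E → ℝ} (hf : ∀ i z, f (z + b i) = f z) (z : E) :
    ∫ h in ZSpan.fundamentalDomain b, f (z + h) ∂μ = ∫ h in ZSpan.fundamentalDomain b, f h ∂μ := by
  have hD := ZSpan.isAddFundamentalDomain' b μ
  have : VAddInvariantMeasure (Submodule.span ℤ (Set.range b)).toAddSubgroup E μ := inferInstance
  have : Countable (Submodule.span ℤ (Set.range b)).toAddSubgroup :=
    inferInstanceAs (Countable (Submodule.span ℤ (Set.range b)))
  have hDz := hD.vadd_of_comm z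
  rw [hD.setIntegral_eq hDz (fun g x => apply_vadd_span_eq b hf g x)]
  have := (measurePreserving_add_left μ z).setIntegral_preimage_emb
    (measurableEmbedding_addLeft z) f (z +ᵥ ZSpan.fundamentalDomain b)
  rw [← this]
  congr 2
  ext x
  simp [Set.mem_vadd_set_iff_neg_vadd_mem]

/-- A bounded periodic function of mean zero, tested against an integrable function `g`, is
controlled by the `L¹` modulus of continuity of `g` over one period. -/
lemma abs_integral_mul_le_of_periodic {μ : Measure E} [μ.IsAddHaarMeasure]
    {f g : E → ℝ} {M K : ℝ} (hfm : Measurable f)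
    (hfM : ∀ z, |f z| ≤ M) (hf : ∀ i z, f (z + b i) = f z)
    (hf0 : ∫ z in ZSpan.fundamentalDomain b, f z ∂μ = 0) (hg : Integrable g μ)
    (hK : ∀ h ∈ ZSpan.fundamentalDomain b, ∫ z, |g z - g (z - h)| ∂μ ≤ K) :
    |∫ z, f z * g z ∂μ| ≤ M * K := by
  have : FiniteDimensional ℝ E := b.finiteDimensional_of_finite
  set D := ZSpan.fundamentalDomain b
  have hDfin : μ D < ⊤ := (ZSpan.fundamentalDomain_isBounded b).measure_lt_top
  have hDpos : 0 < μ.real D :=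
    ENNReal.toReal_pos (ZSpan.measure_fundamentalDomain_ne_zero b) hDfin.ne
  have : IsFiniteMeasure (μ.restrict D) := ⟨by simpa using hDfin⟩
  have hM : 0 ≤ M := (abs_nonneg _).trans (hfM 0)
  have hshift (h : E) : ∫ z, f (z + h) * g z ∂μ = ∫ z, f z * g (z - h) ∂μ := by
    rw [← integral_add_right_eq_self (fun z => f z * g (z - h)) h]
    simp
  have h_int : Integrable (Function.uncurry fun h z => f (z + h) * g z)
      ((μ.restrict D).prod μ) :=
    (hg.comp_snd _).bdd_mul (c := M)
      (hfm.comp (measurable_snd.add measurable_fst)).aestronglyMeasurable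
      (.of_forall fun _ => hfM _)
  have hzero : ∫ h in D, ∫ z, f (z + h) * g z ∂μ ∂μ = 0 := by
    rw [integral_integral_swap h_int]
    have hshift0 (z : E) : ∫ h in D, f (z + h) ∂μ = 0 :=
      (setIntegral_fundamentalDomain_add b hf z).trans hf0
    simp [integral_mul_const, hshift0]
  have hfg {u : E → ℝ} (hu : Integrable u μ) : Integrable (fun z => f z * u z) μ :=
    hu.bdd_mul hfm.aestronglyMeasurable (.of_forall hfM)
  have hmean : ∫ h in D, ((∫ z, f z * g z ∂μ) - ∫ z, f (z + h) * g z ∂μ) ∂μ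
      = μ.real D * ∫ z, f z * g z ∂μ := by
    have h_int_left : Integrable (fun h => ∫ z, f (z + h) * g z ∂μ) (μ.restrict D) :=
      h_int.integral_prod_left
    rw [integral_sub (integrable_const _) h_int_left, hzero]
    simp
  have hbound := norm_setIntegral_le_of_norm_le_const (C := M * K) hDfin
    (f := fun h => (∫ z, f z * g z ∂μ) - ∫ z, f (z + h) * g z ∂μ) fun h hh => by
      rw [hshift, ← integral_sub (hfg hg) (hfg (hg.comp_sub_right h))]
      calc _ ≤ ∫ z, M * |g z - g (z - h)| ∂μ := by
            refine norm_integral_le_of_norm_le ((hg.sub (hg.comp_sub_right h)).abs.const_mul M)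
              (.of_forall fun z => ?_)
            rw [← mul_sub, norm_mul]
            exact mul_le_mul_of_nonneg_right (hfM z) (norm_nonneg _)
        _ ≤ M * K := by
            rw [integral_const_mul]
            exact mul_le_mul_of_nonneg_left (hK h hh) hM
  rw [hmean, norm_mul, Real.norm_of_nonneg hDpos.le, Real.norm_eq_abs, mul_comm] at hbound
  exact le_of_mul_le_mul_right hbound hDpos

end FundamentalDomain

/-- The `L¹` distance of a function to a translate, if its support and the pointwise distance are
controlled. -/
lemma integral_abs_sub_translate_le {E : Type*} [AddGroup E] [MeasurableSpace E]
    [MeasurableAdd E] {μ : Measure E} [μ.IsAddRightInvariant] {g : E → ℝ} {S : Set E} {K : ℝ} (h : E)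
    (hS : MeasurableSet S) (hSfin : μ S ≠ ⊤) (hgS : ∀ z ∉ S, g z = 0)
    (hK : ∀ z, |g z - g (z - h)| ≤ K) :
    ∫ z, |g z - g (z - h)| ∂μ ≤ 2 * K * μ.real S := by
  have hK0 : 0 ≤ K := (abs_nonneg _).trans (hK 0)
  set u : E → ℝ := S.indicator fun _ => K with hu_def
  have hu : Integrable u μ := (integrable_indicator_iff hS).2 (integrableOn_const hSfin)
  have hu0 (z : E) : 0 ≤ u z := Set.indicator_nonneg (fun _ _ => hK0) z
  calc ∫ z, |g z - g (z - h)| ∂μ ≤ ∫ z, (u z + u (z - h)) ∂μ := by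
        refine integral_mono_of_nonneg (.of_forall fun _ => abs_nonneg _)
          (hu.add (hu.comp_sub_right h)) (.of_forall fun z => ?_)
        change |g z - g (z - h)| ≤ u z + u (z - h)
        by_cases hz : z ∈ S
        · have : u z = K := by simp [hu_def, hz]
          linarith [hK z, hu0 (z - h)]
        by_cases hz' : z - h ∈ S
        · have : u (z - h) = K := by simp [hu_def, hz']
          linarith [hK z, hu0 z]
        · rw [hgS z hz, hgS _ hz', sub_zero, abs_zero]
          exact add_nonneg (hu0 _) (hu0 _)
    _ = 2 * K * μ.real S := by
        rw [integral_add hu (hu.comp_sub_right h), integral_sub_right_eq_self u h,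
          integral_indicator_const _ hS, smul_eq_mul]
        ring

/-- The basis of `ℝ^{d+1}` generating the lattice `(εℤ)^d × (ε²ℤ)`. -/
def parabolicBasis (d : ℕ) {ε : ℝ} (hε : ε ≠ 0) : Module.Basis (Fin d ⊕ Unit) ℝ (Pt d) :=
  ((EuclideanSpace.basisFun (Fin d) ℝ).toBasis.prod (Module.Basis.singleton Unit ℝ)).unitsSMul
    (Sum.elim (fun _ => Units.mk0 ε hε) fun _ => Units.mk0 (ε ^ 2) (pow_ne_zero 2 hε))

instance (d : ℕ) : (volume : Measure (Pt d)).IsAddHaarMeasure :=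
  inferInstanceAs (Measure.prod volume volume).IsAddHaarMeasure

section parabolicBasis

variable {d : ℕ} {ε : ℝ}

lemma parabolicBasis_inl (hε : ε ≠ 0) (i : Fin d) :
    parabolicBasis d hε (Sum.inl i) = (ε • EuclideanSpace.single i 1, 0) := by
  simp [parabolicBasis, Module.Basis.unitsSMul_apply, Units.smul_def]

lemma parabolicBasis_inr (hε : ε ≠ 0) (i : Unit) :
    parabolicBasis d hε (Sum.inr i) = (0, ε ^ 2) := by
  simp [parabolicBasis, Module.Basis.unitsSMul_apply, Units.smul_def]

lemma parabolicBasis_repr_inl (hε : ε ≠ 0) (z : Pt d) (i : Fin d) :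
    (parabolicBasis d hε).repr z (Sum.inl i) = z.1 i / ε := by
  simp [parabolicBasis, Module.Basis.repr_unitsSMul, Units.smul_def, div_eq_inv_mul]

lemma parabolicBasis_repr_inr (hε : ε ≠ 0) (z : Pt d) (i : Unit) :
    (parabolicBasis d hε).repr z (Sum.inr i) = z.2 / ε ^ 2 := by
  simp [parabolicBasis, Module.Basis.repr_unitsSMul, Units.smul_def, div_eq_inv_mul]

lemma parallelepiped_parabolicBasis (hε : 0 < ε) :
    parallelepiped (parabolicBasis d hε.ne') = cellSet d ε := by
  ext z
  rw [parallelepiped_basis_eq]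
  simp [cellSet, Set.mem_Icc, parabolicBasis_repr_inl, parabolicBasis_repr_inr,
    div_le_one₀ hε, div_le_one₀ (pow_pos hε 2), le_div_iff₀ hε, le_div_iff₀ (pow_pos hε 2)]

lemma fundamentalDomain_parabolicBasis_subset (hε : 0 < ε) :
    ZSpan.fundamentalDomain (parabolicBasis d hε.ne') ⊆ cellSet d ε :=
  (ZSpan.fundamentalDomain_subset_parallelepiped _).trans (parallelepiped_parabolicBasis hε).subset

lemma setIntegral_fundamentalDomain_parabolicBasis (hε : 0 < ε) (f : Pt d → ℝ) :
    ∫ z in ZSpan.fundamentalDomain (parabolicBasis d hε.ne'), f z = ∫ z in cellSet d ε, f z := by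
  rw [← parallelepiped_parabolicBasis hε]
  exact setIntegral_congr_set (ZSpan.fundamentalDomain_ae_parallelepiped _ volume)

end parabolicBasis

/-- The parabolic size of the points of the periodicity cell. -/
lemma norm_add_sqrt_le_of_mem_cellSet {d : ℕ} {ε : ℝ} (hε : 0 < ε) {h : Pt d}
    (hh : h ∈ cellSet d ε) : ‖h.1‖ + √|h.2| ≤ (d + 1) * ε := by
  have h1 : ‖h.1‖ ≤ d * ε := by
    have hsum := (EuclideanSpace.basisFun (Fin d) ℝ).sum_repr h.1
    calc ‖h.1‖ = ‖∑ i, h.1 i • EuclideanSpace.single i (1 : ℝ)‖ := by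
          conv_lhs => rw [← hsum]
          simp
      _ ≤ ∑ i : Fin d, ε := by
          refine norm_sum_le_of_le _ fun i _ => ?_
          rw [norm_smul, PiLp.norm_single, norm_one, mul_one, Real.norm_eq_abs,
            abs_of_nonneg (hh.1 i).1]
          exact (hh.1 i).2
      _ = d * ε := by simp
  have h2 : √|h.2| ≤ ε := by
    rw [abs_of_nonneg hh.2.1]
    exact Real.sqrt_le_iff.2 ⟨hε.le, hh.2.2⟩
  linarith

/-- The rescaling `φ^λ_{z₀}` of a test function. -/
def rescaledTest {d : ℕ} (φ : Pt d → ℝ) (lam : ℝ) (z₀ z : Pt d) : ℝ :=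
  (lam ^ (d + 2))⁻¹ * φ (lam⁻¹ • (z.1 - z₀.1), (z.2 - z₀.2) / lam ^ 2)

section rescaledTest

variable {d : ℕ} {φ : Pt d → ℝ} {κ lam : ℝ}

lemma continuous_of_pdist_holder (hκ : 0 < κ) (hφ : ∀ z w, |φ z - φ w| ≤ pdist z w ^ κ) :
    Continuous φ := by
  refine continuous_iff_continuousAt.2 fun w => ?_
  rw [ContinuousAt, tendsto_iff_dist_tendsto_zero]
  have hcont : Continuous fun z : Pt d => pdist z w ^ κ := by
    unfold pdist
    exact Continuous.rpow_const (by fun_prop) fun _ => Or.inr hκ.le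
  have hlim := hcont.tendsto w
  simp only [pdist, sub_self, norm_zero, abs_zero, Real.sqrt_zero, add_zero,
    Real.zero_rpow hκ.ne'] at hlim
  exact squeeze_zero (fun _ => dist_nonneg) (fun z => hφ z w) hlim

lemma continuous_rescaledTest (hφ : Continuous φ) (z₀ : Pt d) :
    Continuous (rescaledTest φ lam z₀) := by
  unfold rescaledTest
  fun_prop

lemma rescaledTest_eq_zero (hlam : 0 < lam) (hφ : ∀ z : Pt d, 1 < ‖z.1‖ + √|z.2| → φ z = 0)
    {z₀ z : Pt d} (hz : z ∉ Metric.closedBall z₀.1 lam ×ˢ Metric.closedBall z₀.2 (lam ^ 2)) :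
    rescaledTest φ lam z₀ z = 0 := by
  rw [rescaledTest, hφ, mul_zero]
  rw [Set.mem_prod, not_and_or, Metric.mem_closedBall, Metric.mem_closedBall, not_le, not_le,
    dist_eq_norm, Real.dist_eq] at hz
  rcases hz with hz | hz
  · refine lt_add_of_lt_of_nonneg ?_ (Real.sqrt_nonneg _)
    rw [norm_smul, norm_inv, Real.norm_of_nonneg hlam.le, ← div_eq_inv_mul]
    exact (one_lt_div hlam).2 hz
  · refine lt_add_of_nonneg_of_lt (norm_nonneg _) ?_
    rw [Real.lt_sqrt zero_le_one, one_pow, abs_div, abs_of_pos (pow_pos hlam 2)]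
    exact (one_lt_div (pow_pos hlam 2)).2 hz

lemma abs_rescaledTest_sub_le (hκ : 0 < κ) (hlam : 0 < lam)
    (hφ : ∀ z w, |φ z - φ w| ≤ pdist z w ^ κ) {r : ℝ} (z₀ z : Pt d) {h : Pt d}
    (hh : ‖h.1‖ + √|h.2| ≤ r) :
    |rescaledTest φ lam z₀ z - rescaledTest φ lam z₀ (z - h)| ≤
      (lam ^ (d + 2))⁻¹ * (r / lam) ^ κ := by
  rw [rescaledTest, rescaledTest, ← mul_sub, abs_mul, abs_of_pos (inv_pos.2 (pow_pos hlam _))]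
  refine mul_le_mul_of_nonneg_left ((hφ _ _).trans ?_) (inv_pos.2 (pow_pos hlam _)).le
  have hp : pdist (lam⁻¹ • (z.1 - z₀.1), (z.2 - z₀.2) / lam ^ 2)
      (lam⁻¹ • ((z - h).1 - z₀.1), ((z - h).2 - z₀.2) / lam ^ 2) =
      (‖h.1‖ + √|h.2|) / lam := by
    simp only [pdist, ← smul_sub, ← sub_div, Prod.fst_sub, Prod.snd_sub, sub_sub_sub_cancel_right,
      sub_sub_cancel]
    rw [norm_smul, norm_inv, Real.norm_of_nonneg hlam.le, abs_div, abs_of_pos (pow_pos hlam 2),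
      Real.sqrt_div (abs_nonneg _), Real.sqrt_sq hlam.le]
    ring
  rw [hp]
  exact Real.rpow_le_rpow (by positivity) (by gcongr) hκ.le

end rescaledTest

/-- The volume of a parabolic cylinder of radius `r`. -/
lemma volume_real_parabolicCylinder {d : ℕ} {r : ℝ} (hr : 0 ≤ r) (z₀ : Pt d) :
    (volume : Measure (Pt d)).real
      (Metric.closedBall z₀.1 r ×ˢ Metric.closedBall z₀.2 (r ^ 2)) =
      2 * volume.real (Metric.closedBall (0 : EuclideanSpace ℝ (Fin d)) 1) * r ^ (d + 2) := by
  rw [Measure.volume_eq_prod, measureReal_prod_prod, Measure.addHaar_real_closedBall' _ _ hr,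
    Real.volume_real_closedBall (by positivity), finrank_euclideanSpace_fin]
  ring

theorem stmt8 (d : ℕ) (hd : 1 ≤ d) (κ : ℝ) (hκ₁ : 0 < κ) (hκ₂ : κ < 1) :
    ∃ C : ℝ, 0 < C ∧
      ∀ ε : ℝ, 0 < ε → ε ≤ 1 →
      ∀ (f : Pt d → ℝ) (Mf : ℝ),
        -- `f` bounded and measurable
        Measurable f → (∀ z, |f z| ≤ Mf) →
        -- `(εℤ)^d × (ε²ℤ)`-periodic
        (∀ (z : Pt d) (i : Fin d), f (z.1 + ε • EuclideanSpace.single i 1, z.2) = f z) →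
        (∀ z : Pt d, f (z.1, z.2 + ε ^ 2) = f z) →
        -- vanishing mean over the periodicity cell
        (∫ z in cellSet d ε, f z) = 0 →
        ∀ lam : ℝ, 0 < lam → lam ≤ 1 → ∀ (z₀ : Pt d) (φ : Pt d → ℝ),
          -- `φ` supported in the parabolic unit ball ...
          (∀ z : Pt d, 1 < ‖z.1‖ + Real.sqrt |z.2| → φ z = 0) →
          -- ... with `sup|φ| ≤ 1` and parabolic `κ`-Hölder constant ≤ 1
          (∀ z, |φ z| ≤ 1) →
          (∀ z w, |φ z - φ w| ≤ pdist z w ^ κ) →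
          |∫ z : Pt d, f z *
              ((lam ^ (d + 2))⁻¹ * φ (lam⁻¹ • (z.1 - z₀.1), (z.2 - z₀.2) / lam ^ 2))| ≤
            C * ε ^ κ * lam ^ (-κ) * Mf := by
  set V := volume.real (Metric.closedBall (0 : EuclideanSpace ℝ (Fin d)) 1)
  have hV : 0 < V := ENNReal.toReal_pos
    (Metric.measure_closedBall_pos _ _ one_pos).ne' measure_closedBall_lt_top.ne
  refine ⟨4 * V * (d + 1) ^ κ, by positivity, ?_⟩
  intro ε hε _ f Mf hfm hfM hfx hft hf0 lam hlam _ z₀ φ hφs _ hφκ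
  set S := Metric.closedBall z₀.1 lam ×ˢ Metric.closedBall z₀.2 (lam ^ 2)
  have hScpt : IsCompact S := (isCompact_closedBall _ _).prod (isCompact_closedBall _ _)
  have hg0 (z : Pt d) (hz : z ∉ S) : rescaledTest φ lam z₀ z = 0 := rescaledTest_eq_zero hlam hφs hz
  have hg : Integrable (rescaledTest φ lam z₀) :=
    (continuous_rescaledTest (continuous_of_pdist_holder hκ₁ hφκ) z₀).integrable_of_hasCompactSupport
      (HasCompactSupport.intro hScpt hg0)
  have hper (i : Fin d ⊕ Unit) (z : Pt d) : f (z + parabolicBasis d hε.ne' i) = f z := by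
    rcases i with i | i
    · rw [parabolicBasis_inl, ← hfx z i]
      simp [Prod.add_def]
    · rw [parabolicBasis_inr, ← hft z]
      simp [Prod.add_def]
  have key := abs_integral_mul_le_of_periodic (parabolicBasis d hε.ne') (μ := volume) hfm hfM hper
    ((setIntegral_fundamentalDomain_parabolicBasis hε f).trans hf0) hg fun h hh =>
      integral_abs_sub_translate_le h hScpt.measurableSet hScpt.measure_ne_top hg0 fun z =>
        abs_rescaledTest_sub_le hκ₁ hlam hφκ z₀ z <|
          norm_add_sqrt_le_of_mem_cellSet hε (fundamentalDomain_parabolicBasis_subset hε hh)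
  refine key.trans_eq ?_
  rw [volume_real_parabolicCylinder hlam.le, Real.div_rpow (by positivity) hlam.le,
    Real.mul_rpow (by positivity) hε.le, Real.rpow_neg hlam.le]
  field_simp
  ring
end
end

section
/- Let d ≥ 1 and set |s| := d+2. Let β₁ ∈ (−1,0), β₂ ∈ (0,|s|) with 0 < β₁+β₂ < |s|, and L' ∈ (−β₁, 1). Let C₁, C₂ > 0, let K₁ : ℝ^{d+1} × ℝ^{d+1} → ℝ be measurable with K₁(x,y) = 0 whenever |x−y|_s > 1 and |K₁(x,y)| ≤ C₁ |x−y|_s^{β₁−|s|}, let f ∈ L^∞(ℝ^{d+1}), and let (K_{2,n})_{n≥0} be measurable functions on ℝ^{d+1} × ℝ^{d+1} with K_{2,n}(y,z) = 0 whenever |y−z|_s > 2^{−n}, |K_{2,n}(y,z)| ≤ C₂ 2^{n(|s|−β₂)}, and |K_{2,n}(y,z) − K_{2,n}(x,z)| ≤ C₂ 2^{n(|s|−β₂+L')} |x−y|_s^{L'} for all x, y, z. Then there is C = C(d,β₁,β₂,L') such that for all x ≠ z in ℝ^{d+1}: for each n the renormalised integral ∫_{ℝ^{d+1}} K₁(x,y)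 f(y) [K_{2,n}(y,z) − K_{2,n}(x,z)] dy converges absolutely, and Σ_{n≥0} |∫_{ℝ^{d+1}} K₁(x,y) f(y) [K_{2,n}(y,z) − K_{2,n}(x,z)] dy| ≤ C C₁ C₂ ‖f‖_{L^∞} |x−z|_s^{β₁+β₂−|s|}. -/
/-!
**Statement 10** (renormalised kernel composition, pointwise form of the first
estimate of Lemma A.2).

`|s| = d + 2` is the parabolic dimension.  `K₁` is a kernel of order
`β₁ − |s|` supported at parabolic distance ≤ 1 from the diagonal, `f ∈ L^∞`,
and `(K_{2,n})` is a dyadic family for a kernel of order `β₂`.  The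
renormalised composition `ℛ(K₁·f) ⋆ K₂` is then a kernel of order
`β₁ + β₂ − |s|`: here the sum over `n` of the absolute values of the
renormalised integrals is expressed through all its partial sums.
-/

open MeasureTheory

noncomputable section

/-! ### Dyadic integration of powers against a measure of polynomial growth -/

lemma tsum_ofReal_mul_geometric_le {B q : ℝ} (hB : 0 ≤ B) (hq0 : 0 ≤ q) (hq1 : q < 1) :
    ∑' k : ℕ, ENNReal.ofReal (B * q ^ k) = ENNReal.ofReal (B * (1 - q)⁻¹) := by
  rw [← ENNReal.ofReal_tsum_of_nonneg (fun k => by positivity)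
    ((summable_geometric_of_lt_one hq0 hq1).mul_left B), tsum_mul_left,
    tsum_geometric_of_lt_one hq0 hq1]

section PolynomialGrowth

variable {X : Type*} [MeasurableSpace X] {μ : Measure X} {p : X → ℝ} {c s : ℝ}

lemma setLIntegral_annulus_rpow_le (hp : Measurable p)
    (hμ : ∀ r, 0 < r → μ {y | p y ≤ r} ≤ ENNReal.ofReal (c * r ^ s))
    {e ρ : ℝ} (hρ : 0 < ρ) (he : e ≤ 0) :
    ∫⁻ y in {y | ρ ≤ p y ∧ p y ≤ 2 * ρ}, ENNReal.ofReal (p y ^ e) ∂μ ≤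
      ENNReal.ofReal (c * 2 ^ s * ρ ^ (e + s)) := by
  have hmeas : MeasurableSet {y | ρ ≤ p y ∧ p y ≤ 2 * ρ} :=
    (measurableSet_le measurable_const hp).inter (measurableSet_le hp measurable_const)
  calc ∫⁻ y in {y | ρ ≤ p y ∧ p y ≤ 2 * ρ}, ENNReal.ofReal (p y ^ e) ∂μ
      ≤ ∫⁻ _ in {y | ρ ≤ p y ∧ p y ≤ 2 * ρ}, ENNReal.ofReal (ρ ^ e) ∂μ :=
        setLIntegral_mono' hmeas fun y hy =>
          ENNReal.ofReal_le_ofReal (Real.rpow_le_rpow_of_nonpos hρ hy.1 he)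
    _ ≤ ENNReal.ofReal (ρ ^ e) * ENNReal.ofReal (c * (2 * ρ) ^ s) := by
        rw [setLIntegral_const]
        gcongr
        exact (measure_mono fun y hy => hy.2).trans (hμ (2 * ρ) (by positivity))
    _ = ENNReal.ofReal (c * 2 ^ s * ρ ^ (e + s)) := by
        rw [← ENNReal.ofReal_mul (by positivity), Real.mul_rpow (by norm_num) hρ.le,
          Real.rpow_add hρ]
        congr 1; ring

lemma setLIntegral_rpow_le_of_subset_iUnion_annuli (hp : Measurable p) (hc : 0 ≤ c)
    (hμ : ∀ r, 0 < r → μ {y | p y ≤ r} ≤ ENNReal.ofReal (c * r ^ s))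
    {e B q : ℝ} {ρ : ℕ → ℝ} {S : Set X} (hρ : ∀ k, 0 < ρ k) (he : e < 0)
    (hB : 0 ≤ B) (hq0 : 0 ≤ q) (hq1 : q < 1) (hρq : ∀ k, ρ k ^ (e + s) ≤ B * q ^ k)
    (hS : ∀ y ∈ S, p y ≠ 0 → ∃ k, ρ k ≤ p y ∧ p y ≤ 2 * ρ k) :
    ∫⁻ y in S, ENNReal.ofReal (p y ^ e) ∂μ ≤
      ENNReal.ofReal (c * 2 ^ s * B * (1 - q)⁻¹) := by
  have hsub : S ⊆ {y | p y = 0} ∪ ⋃ k, {y | ρ k ≤ p y ∧ p y ≤ 2 * ρ k} := by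
    intro y hy
    by_cases h0 : p y = 0
    · exact Or.inl h0
    · exact Or.inr (Set.mem_iUnion.2 (hS y hy h0))
  have hzero : ∫⁻ y in {y | p y = 0}, ENNReal.ofReal (p y ^ e) ∂μ = 0 := by
    refine setLIntegral_eq_zero (measurableSet_eq_fun hp measurable_const) fun y hy => ?_
    have hy' : p y = 0 := hy
    simp [hy', Real.zero_rpow he.ne]
  calc ∫⁻ y in S, ENNReal.ofReal (p y ^ e) ∂μ
      ≤ _ := lintegral_mono_set hsub
    _ ≤ _ := lintegral_union_le _ _ _
    _ ≤ ∑' k : ℕ, ∫⁻ y in {y | ρ k ≤ p y ∧ p y ≤ 2 * ρ k}, ENNReal.ofReal (p y ^ e) ∂μ := by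
        rw [hzero, zero_add]
        exact lintegral_iUnion_le _ _
    _ ≤ ∑' k : ℕ, ENNReal.ofReal (c * 2 ^ s * B * q ^ k) := by
        refine ENNReal.tsum_le_tsum fun k =>
          (setLIntegral_annulus_rpow_le hp hμ (hρ k) he.le).trans ?_
        rw [mul_assoc (c * 2 ^ s)]
        gcongr
        exact hρq k
    _ = _ := tsum_ofReal_mul_geometric_le (by positivity) hq0 hq1

lemma setLIntegral_rpow_near_le (hp : Measurable p) (hp0 : ∀ y, 0 ≤ p y) (hc : 0 ≤ c)
    (hμ : ∀ r, 0 < r → μ {y | p y ≤ r} ≤ ENNReal.ofReal (c * r ^ s))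
    {a r : ℝ} (hr : 0 < r) (ha : 0 < a) (has : a < s) :
    ∫⁻ y in {y | p y ≤ r}, ENNReal.ofReal (p y ^ (a - s)) ∂μ ≤
      ENNReal.ofReal (c * 2 ^ s * r ^ a * (1 - (1 / 2) ^ a)⁻¹) := by
  refine setLIntegral_rpow_le_of_subset_iUnion_annuli hp hc hμ (q := (1 / 2) ^ a)
    (ρ := fun k => r * (1 / 2) ^ (k + 1)) (fun k => by positivity) (by linarith)
    (by positivity) (by positivity) (Real.rpow_lt_one (by norm_num) (by norm_num) ha)
    (fun k => ?_) fun y hy h0 => ?_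
  · rw [sub_add_cancel, Real.mul_rpow hr.le (by positivity), ← Real.rpow_natCast_mul (by norm_num),
      ← Real.rpow_mul_natCast (by norm_num)]
    gcongr 1
    refine Real.rpow_le_rpow_of_exponent_ge (by norm_num) (by norm_num) ?_
    push_cast
    nlinarith
  · have hpos : 0 < p y := lt_of_le_of_ne (hp0 y) (Ne.symm h0)
    obtain ⟨k, hk1, hk2⟩ := exists_nat_pow_near_of_lt_one (div_pos hpos hr)
      ((div_le_one hr).2 hy) (show (0 : ℝ) < 1 / 2 by norm_num) (by norm_num)
    rw [lt_div_iff₀ hr] at hk1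
    rw [div_le_iff₀ hr] at hk2
    exact ⟨k, by linarith, by rw [pow_succ]; linarith⟩

lemma setLIntegral_rpow_far_le (hp : Measurable p) (hc : 0 ≤ c)
    (hμ : ∀ r, 0 < r → μ {y | p y ≤ r} ≤ ENNReal.ofReal (c * r ^ s))
    {a r : ℝ} (hr : 0 < r) (ha : a < 0) (has : a < s) :
    ∫⁻ y in {y | p y ≤ r}ᶜ, ENNReal.ofReal (p y ^ (a - s)) ∂μ ≤
      ENNReal.ofReal (c * 2 ^ s * r ^ a * (1 - 2 ^ a)⁻¹) := by
  refine setLIntegral_rpow_le_of_subset_iUnion_annuli hp hc hμ (q := 2 ^ a)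
    (ρ := fun k => r * 2 ^ k) (fun k => by positivity) (by linarith)
    (by positivity) (by positivity) (Real.rpow_lt_one_of_one_lt_of_neg (by norm_num) ha)
    (fun k => ?_) fun y hy _ => ?_
  · rw [sub_add_cancel, Real.mul_rpow hr.le (by positivity), ← Real.rpow_natCast_mul (by norm_num),
      ← Real.rpow_mul_natCast (by norm_num), mul_comm a]
  · have hlt : r < p y := not_le.1 hy
    have hpos : 0 < p y := hr.trans hlt
    obtain ⟨k, hk1, hk2⟩ := exists_nat_pow_near_of_lt_one (div_pos hr hpos)
      ((div_le_one hpos).2 hlt.le) (show (0 : ℝ) < 1 / 2 by norm_num) (by norm_num)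
    rw [lt_div_iff₀ hpos, one_div_pow, pow_succ, div_mul_eq_mul_div, div_lt_iff₀ (by positivity)]
      at hk1
    rw [div_le_iff₀ hpos, one_div_pow, div_mul_eq_mul_div, le_div_iff₀ (by positivity)] at hk2
    exact ⟨k, by linarith, by linarith⟩

end PolynomialGrowth

/-! ### Dyadic sums -/

lemma sum_ite_le_two_rpow_le {γ D : ℝ} (hγ : 0 < γ) (hD : 0 < D) (N : ℕ) :
    ∑ n ∈ Finset.range N, (if 2 ^ n * D ≤ 2 then (2 ^ n * D) ^ γ else 0) ≤
      4 ^ γ * (2 ^ γ - 1)⁻¹ := by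
  have hq : 0 < (2 : ℝ) ^ γ - 1 := sub_pos.2 (Real.one_lt_rpow (by norm_num) hγ)
  have hgeom : ∀ N : ℕ, ∑ n ∈ Finset.range N,
      (if 2 ^ n * D ≤ 2 then (2 ^ n * D) ^ γ else 0) ≤ (2 ^ N * D) ^ γ * (2 ^ γ - 1)⁻¹ := by
    intro N
    induction N with
    | zero => simp only [Finset.range_zero, Finset.sum_empty]; positivity
    | succ N ih =>
      rw [Finset.sum_range_succ]
      have hstep : (2 ^ (N + 1) * D) ^ γ * (2 ^ γ - 1)⁻¹ =
          (2 ^ N * D) ^ γ * (2 ^ γ - 1)⁻¹ + (2 ^ N * D) ^ γ := by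
        rw [show (2 : ℝ) ^ (N + 1) * D = 2 * (2 ^ N * D) by ring,
          Real.mul_rpow (by norm_num) (by positivity)]
        field_simp
        ring
      rw [hstep]
      gcongr
      split_ifs
      · exact le_rfl
      · positivity
  induction N with
  | zero => simp only [Finset.range_zero, Finset.sum_empty]; positivity
  | succ N ih =>
    by_cases h : 2 ^ N * D ≤ 2
    · refine (hgeom (N + 1)).trans ?_
      gcongr
      rw [pow_succ]
      linarith
    · rwa [Finset.sum_range_succ, if_neg h, add_zero]

lemma sum_ite_two_lt_rpow_neg_le {β : ℝ} (hβ : 0 < β) (N : ℕ) {D : ℝ} (hD : 0 < D) :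
    ∑ n ∈ Finset.range N, (if 2 ^ n * D ≤ 2 then 0 else (2 ^ n * D) ^ (-β)) ≤
      (1 - 2 ^ (-β))⁻¹ := by
  have hq1 : (2 : ℝ) ^ (-β) < 1 := Real.rpow_lt_one_of_one_lt_of_neg (by norm_num) (by linarith)
  have hq : 0 < 1 - (2 : ℝ) ^ (-β) := sub_pos.2 hq1
  have hgeom : ∀ (N : ℕ) (D : ℝ), 0 < D → ∑ n ∈ Finset.range N,
      (if 2 ^ n * D ≤ 2 then 0 else (2 ^ n * D) ^ (-β)) ≤ D ^ (-β) * (1 - 2 ^ (-β))⁻¹ := by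
    intro N
    induction N with
    | zero => intro D hD; simp only [Finset.range_zero, Finset.sum_empty]; positivity
    | succ N ih =>
      intro D hD
      have hstep : D ^ (-β) * (1 - 2 ^ (-β))⁻¹ =
          (2 * D) ^ (-β) * (1 - 2 ^ (-β))⁻¹ + D ^ (-β) := by
        rw [Real.mul_rpow (by norm_num) hD.le]
        field_simp
        ring
      rw [Finset.sum_range_succ', hstep]
      simp only [pow_succ, mul_assoc, pow_zero, one_mul]
      gcongr
      · exact ih (2 * D) (by positivity)
      · split_ifs
        · positivity
        · exact le_rfl
  induction N generalizing D with
  | zero => simp only [Finset.range_zero, Finset.sum_empty]; positivity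
  | succ N ih =>
    by_cases h : D ≤ 2
    · rw [Finset.sum_range_succ']
      simp only [pow_succ, mul_assoc, pow_zero, one_mul, if_pos h, add_zero]
      exact ih (D := 2 * D) (by positivity)
    · refine (hgeom (N + 1) D hD).trans (mul_le_of_le_one_left (by positivity) ?_)
      exact Real.rpow_le_one_of_one_le_of_nonpos (by linarith) (by linarith)

/-! ### The parabolic distance -/

lemma pdist_nonneg {d : ℕ} (z w : Pt d) : 0 ≤ pdist z w := by
  unfold pdist; positivity

lemma pdist_comm {d : ℕ} (z w : Pt d) : pdist z w = pdist w z := by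
  simp only [pdist, norm_sub_rev z.1, abs_sub_comm z.2]

lemma pdist_self {d : ℕ} (z : Pt d) : pdist z z = 0 := by
  simp [pdist]

lemma pdist_pos {d : ℕ} {z w : Pt d} (h : z ≠ w) : 0 < pdist z w := by
  refine lt_of_le_of_ne (pdist_nonneg z w) fun h0 => h ?_
  obtain ⟨h1, h2⟩ := (add_eq_zero_iff_of_nonneg (norm_nonneg _) (Real.sqrt_nonneg _)).1 h0.symm
  rw [Real.sqrt_eq_zero (abs_nonneg _), abs_eq_zero] at h2
  exact Prod.ext (sub_eq_zero.1 (norm_eq_zero.1 h1)) (sub_eq_zero.1 h2)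

lemma pdist_triangle {d : ℕ} (x y z : Pt d) : pdist x z ≤ pdist x y + pdist y z := by
  have h1 : ‖x.1 - z.1‖ ≤ ‖x.1 - y.1‖ + ‖y.1 - z.1‖ := norm_sub_le_norm_sub_add_norm_sub _ _ _
  have h2 : √|x.2 - z.2| ≤ √|x.2 - y.2| + √|y.2 - z.2| := by
    refine Real.sqrt_le_iff.2 ⟨by positivity, ?_⟩
    have := abs_sub_le x.2 y.2 z.2
    nlinarith [Real.sq_sqrt (abs_nonneg (x.2 - y.2)), Real.sq_sqrt (abs_nonneg (y.2 - z.2)),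
      mul_nonneg (Real.sqrt_nonneg |x.2 - y.2|) (Real.sqrt_nonneg |y.2 - z.2|)]
  unfold pdist
  linarith

lemma measurable_pdist {d : ℕ} (x : Pt d) : Measurable (pdist x) := by
  unfold pdist; fun_prop

lemma exists_volume_pdist_le (d : ℕ) :
    ∃ c : ℝ, 0 ≤ c ∧ ∀ (x : Pt d) (r : ℝ), 0 < r →
      volume {y | pdist x y ≤ r} ≤ ENNReal.ofReal (c * r ^ ((d : ℝ) + 2)) := by
  refine ⟨2 * (volume (Metric.ball (0 : EuclideanSpace ℝ (Fin d)) 1)).toReal, by positivity,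
    fun x r hr => ?_⟩
  have hsub : {y : Pt d | pdist x y ≤ r} ⊆
      Metric.closedBall x.1 r ×ˢ Set.Icc (x.2 - r ^ 2) (x.2 + r ^ 2) := by
    intro y hy
    have hy' : ‖x.1 - y.1‖ + √|x.2 - y.2| ≤ r := hy
    have h1 : ‖x.1 - y.1‖ ≤ r := by linarith [Real.sqrt_nonneg |x.2 - y.2|]
    have h2 : |x.2 - y.2| ≤ r ^ 2 :=
      (Real.sqrt_le_left hr.le).1 (by linarith [norm_nonneg (x.1 - y.1)])
    rw [abs_le] at h2
    exact ⟨by rwa [Metric.mem_closedBall, dist_comm, dist_eq_norm],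
      by linarith, by linarith⟩
  refine (measure_mono hsub).trans (le_of_eq ?_)
  rw [Measure.volume_eq_prod, Measure.prod_prod, Measure.addHaar_closedBall _ _ hr.le,
    Real.volume_Icc, ← ENNReal.ofReal_toReal (measure_ball_lt_top (μ := volume)
      (x := (0 : EuclideanSpace ℝ (Fin d))) (r := 1)).ne, ENNReal.toReal_ofReal (by positivity),
    ← ENNReal.ofReal_mul (by positivity), ← ENNReal.ofReal_mul (by positivity),
    Real.rpow_add hr, Real.rpow_natCast, Real.rpow_two, finrank_euclideanSpace, Fintype.card_fin]
  congr 1; ring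

/-! ### Bounds on a single renormalised integral -/

section Renormalised

variable {d : ℕ} {β C₁ M A c : ℝ} {K f G : Pt d → ℝ} {x : Pt d}

lemma lintegral_renormalised_le {L H r : ℝ} (hc : 0 ≤ c)
    (hvol : ∀ (x : Pt d) (r : ℝ), 0 < r →
      volume {y | pdist x y ≤ r} ≤ ENNReal.ofReal (c * r ^ ((d : ℝ) + 2)))
    (hC₁ : 0 ≤ C₁) (hM : 0 ≤ M) (hA : 0 ≤ A) (hH : 0 ≤ H) (hr : 0 < r)
    (hβ : β < 0) (hβL : 0 < β + L) (hL : L < 1)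
    (hK : ∀ y, x ≠ y → |K y| ≤ C₁ * pdist x y ^ (β - ((d : ℝ) + 2)))
    (hf : ∀ y, |f y| ≤ M) (hG : ∀ y, |G y| ≤ A)
    (hGL : ∀ y, |G y - G x| ≤ H * pdist x y ^ L) :
    ∫⁻ y, ‖K y * f y * (G y - G x)‖ₑ ≤ ENNReal.ofReal
      (C₁ * M * H * (c * 2 ^ ((d : ℝ) + 2) * r ^ (β + L) * (1 - (1 / 2) ^ (β + L))⁻¹) +
        C₁ * M * (2 * A) * (c * 2 ^ ((d : ℝ) + 2) * r ^ β * (1 - 2 ^ β)⁻¹)) := by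
  have hd : (0 : ℝ) ≤ d := d.cast_nonneg
  have hp := measurable_pdist x
  have hS : MeasurableSet {y | pdist x y ≤ r} := measurableSet_le hp measurable_const
  have h1 : (1 / 2 : ℝ) ^ (β + L) < 1 := Real.rpow_lt_one (by norm_num) (by norm_num) hβL
  have h2 : (2 : ℝ) ^ β < 1 := Real.rpow_lt_one_of_one_lt_of_neg (by norm_num) hβ
  have h1' := sub_pos.2 h1
  have h2' := sub_pos.2 h2
  have hKf : ∀ y, x ≠ y → |K y * f y| ≤ C₁ * M * pdist x y ^ (β - ((d : ℝ) + 2)) := by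
    intro y hxy
    rw [abs_mul, mul_right_comm]
    exact mul_le_mul (hK y hxy) (hf y) (abs_nonneg _) ((abs_nonneg _).trans (hK y hxy))
  rw [← lintegral_add_compl _ hS, ENNReal.ofReal_add (by positivity) (by positivity),
    ENNReal.ofReal_mul (p := C₁ * M * H) (by positivity),
    ENNReal.ofReal_mul (p := C₁ * M * (2 * A)) (by positivity)]
  refine add_le_add ?_ ?_
  · refine le_trans ?_ (mul_le_mul_right (setLIntegral_rpow_near_le hp (pdist_nonneg x) hc
      (hvol x) hr hβL (by linarith)) _)
    rw [← lintegral_const_mul' _ _ ENNReal.ofReal_ne_top]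
    refine setLIntegral_mono' hS fun y _ => ?_
    rw [← ENNReal.ofReal_mul (by positivity), Real.enorm_eq_ofReal_abs]
    refine ENNReal.ofReal_le_ofReal ?_
    have hpn := pdist_nonneg x y
    by_cases hxy : x = y
    · subst hxy
      simp only [sub_self, mul_zero, abs_zero]
      positivity
    · have hpos := pdist_pos hxy
      rw [abs_mul]
      refine (mul_le_mul (hKf y hxy) (hGL y) (abs_nonneg _) (by positivity)).trans_eq ?_
      rw [show β + L - ((d : ℝ) + 2) = (β - ((d : ℝ) + 2)) + L by ring, Real.rpow_add hpos]
      ring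
  · refine le_trans ?_ (mul_le_mul_right (setLIntegral_rpow_far_le hp hc
      (hvol x) hr hβ (by linarith)) _)
    rw [← lintegral_const_mul' _ _ ENNReal.ofReal_ne_top]
    refine setLIntegral_mono' hS.compl fun y hy => ?_
    rw [← ENNReal.ofReal_mul (by positivity), Real.enorm_eq_ofReal_abs]
    refine ENNReal.ofReal_le_ofReal ?_
    have hlt : r < pdist x y := not_le.1 hy
    have hpos : 0 < pdist x y := hr.trans hlt
    have hxy : x ≠ y := by
      rintro rfl
      rw [pdist_self] at hpos
      exact hpos.false
    have hdiff : |G y - G x| ≤ 2 * A := (abs_sub _ _).trans (by linarith [hG y, hG x])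
    rw [abs_mul]
    refine (mul_le_mul (hKf y hxy) hdiff (abs_nonneg _) (by positivity)).trans_eq ?_
    ring

lemma lintegral_renormalised_le_of_separated {r : ℝ} {z : Pt d}
    (hvol : ∀ (x : Pt d) (r : ℝ), 0 < r →
      volume {y | pdist x y ≤ r} ≤ ENNReal.ofReal (c * r ^ ((d : ℝ) + 2)))
    (hC₁ : 0 ≤ C₁) (hM : 0 ≤ M) (hA : 0 ≤ A) (hr : 0 < r) (hβ : β < 0)
    (hK : ∀ y, x ≠ y → |K y| ≤ C₁ * pdist x y ^ (β - ((d : ℝ) + 2)))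
    (hf : ∀ y, |f y| ≤ M) (hG : ∀ y, |G y| ≤ A)
    (hsupp : ∀ y, r < pdist y z → G y = 0) (hsep : 2 * r < pdist x z) :
    ∫⁻ y, ‖K y * f y * (G y - G x)‖ₑ ≤ ENNReal.ofReal
      (C₁ * (pdist x z / 2) ^ (β - ((d : ℝ) + 2)) * M * A * (c * r ^ ((d : ℝ) + 2))) := by
  have hd : (0 : ℝ) ≤ d := d.cast_nonneg
  have hD : 0 < pdist x z := by linarith
  have hGx : G x = 0 := hsupp x (by linarith)
  have hS : MeasurableSet {y | pdist z y ≤ r} :=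
    measurableSet_le (measurable_pdist z) measurable_const
  have hsub : (Function.support fun y => ‖K y * f y * (G y - G x)‖ₑ) ⊆ {y | pdist z y ≤ r} := by
    intro y hy
    by_contra hlt
    refine hy ?_
    have hlt' : r < pdist y z := by
      rw [pdist_comm]
      exact not_le.1 hlt
    simp [hsupp y hlt', hGx]
  rw [← setLIntegral_eq_of_support_subset hsub]
  calc ∫⁻ y in {y | pdist z y ≤ r}, ‖K y * f y * (G y - G x)‖ₑ
      ≤ ∫⁻ _ in {y | pdist z y ≤ r}, ENNReal.ofReal
          (C₁ * (pdist x z / 2) ^ (β - ((d : ℝ) + 2)) * M * A) := by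
        refine setLIntegral_mono' hS fun y hy => ?_
        rw [Real.enorm_eq_ofReal_abs]
        refine ENNReal.ofReal_le_ofReal ?_
        have hzy : pdist y z ≤ r := by rw [pdist_comm]; exact hy
        have hxy : pdist x z / 2 ≤ pdist x y := by linarith [pdist_triangle x y z]
        have hne : x ≠ y := by
          rintro rfl
          linarith
        rw [hGx, sub_zero, abs_mul, abs_mul]
        gcongr
        · refine (hK y hne).trans ?_
          gcongr 1
          exact Real.rpow_le_rpow_of_nonpos (by positivity) hxy (by linarith)
        · exact hf y
        · exact hG y
    _ ≤ _ := by
        rw [setLIntegral_const, ENNReal.ofReal_mul (q := c * r ^ ((d : ℝ) + 2)) (by positivity)]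
        gcongr
        exact hvol z r hr

end Renormalised

lemma abs_integral_le_of_lintegral_enorm_le {X : Type*} [MeasurableSpace X] {μ : Measure X}
    {F : X → ℝ} {B : ℝ} (hB : 0 ≤ B) (h : ∫⁻ y, ‖F y‖ₑ ∂μ ≤ ENNReal.ofReal B) :
    |∫ y, F y ∂μ| ≤ B := by
  have := (enorm_integral_le_lintegral_enorm F).trans h
  rwa [Real.enorm_eq_ofReal_abs, ENNReal.ofReal_le_ofReal_iff hB] at this

theorem stmt10 (d : ℕ) (hd : 1 ≤ d) (β₁ β₂ L' : ℝ)
    (hb1 : -1 < β₁) (hb2 : β₁ < 0) (hb3 : 0 < β₂) (hb4 : β₂ < (d : ℝ) + 2)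
    (hb5 : 0 < β₁ + β₂) (hb6 : β₁ + β₂ < (d : ℝ) + 2)
    (hL1 : -β₁ < L') (hL2 : L' < 1) :
    ∃ C : ℝ, 0 < C ∧
      ∀ (C₁ C₂ Mf : ℝ) (K₁ : Pt d → Pt d → ℝ) (f : Pt d → ℝ) (K₂ : ℕ → Pt d → Pt d → ℝ),
        -- `K₁` measurable, supported at parabolic distance ≤ 1, of order `β₁ − |s|`
        Measurable (Function.uncurry K₁) →
        (∀ x y : Pt d, 1 < pdist x y → K₁ x y = 0) →
        (∀ x y : Pt d, x ≠ y → |K₁ x y| ≤ C₁ * pdist x y ^ (β₁ - ((d : ℝ) + 2))) →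
        -- `f ∈ L^∞`
        Measurable f → (∀ y, |f y| ≤ Mf) →
        -- `(K_{2,n})` measurable dyadic family: supports, size, `L'`-Hölder in 1st variable
        (∀ n, Measurable (Function.uncurry (K₂ n))) →
        (∀ (n : ℕ) (y z : Pt d), (2 : ℝ) ^ (-(n : ℝ)) < pdist y z → K₂ n y z = 0) →
        (∀ (n : ℕ) (y z : Pt d), |K₂ n y z| ≤ C₂ * 2 ^ ((n : ℝ) * (((d : ℝ) + 2) - β₂))) →
        (∀ (n : ℕ) (x y z : Pt d),
            |K₂ n y z - K₂ n x z| ≤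
              C₂ * 2 ^ ((n : ℝ) * (((d : ℝ) + 2) - β₂ + L')) * pdist x y ^ L') →
        ∀ x z : Pt d, x ≠ z →
          -- each renormalised integral converges absolutely ...
          (∀ n : ℕ, Integrable fun y : Pt d => K₁ x y * f y * (K₂ n y z - K₂ n x z)) ∧
          -- ... and `Σ_{n≥0} |∫ K₁(x,y) f(y) [K₂ₙ(y,z) − K₂ₙ(x,z)] dy|
          --        ≤ C C₁ C₂ ‖f‖_∞ |x−z|_s^{β₁+β₂−|s|}`
          ∀ N : ℕ,
            ∑ n ∈ Finset.range N,
              |∫ y : Pt d, K₁ x y * f y * (K₂ n y z - K₂ n x z)| ≤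
            C * C₁ * C₂ * Mf * pdist x z ^ (β₁ + β₂ - ((d : ℝ) + 2)) := by
  obtain ⟨c, hc, hvol⟩ := exists_volume_pdist_le d
  have hd0 : (0 : ℝ) ≤ d := d.cast_nonneg
  have hβL : 0 < β₁ + L' := by linarith
  set s : ℝ := (d : ℝ) + 2 with hs
  set γ : ℝ := s - β₁ - β₂ with hγ_def
  have hγ : 0 < γ := by linarith
  have h1 : 0 < 1 - (1 / 2 : ℝ) ^ (β₁ + L') :=
    sub_pos.2 (Real.rpow_lt_one (by norm_num) (by norm_num) hβL)
  have h2 : 0 < 1 - (2 : ℝ) ^ β₁ :=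
    sub_pos.2 (Real.rpow_lt_one_of_one_lt_of_neg (by norm_num) hb2)
  have h3 : 0 < (2 : ℝ) ^ γ - 1 := sub_pos.2 (Real.one_lt_rpow (by norm_num) hγ)
  have h4 : 0 < 1 - (2 : ℝ) ^ (-β₂) :=
    sub_pos.2 (Real.rpow_lt_one_of_one_lt_of_neg (by norm_num) (by linarith))
  set κ : ℝ := c * 2 ^ s * ((1 - (1 / 2) ^ (β₁ + L'))⁻¹ + 2 * (1 - 2 ^ β₁)⁻¹) with hκ_def
  have hκ : 0 ≤ κ := by positivity
  set η : ℝ := c * 2 ^ (s - β₁) with hη_def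
  have hη : 0 ≤ η := by positivity
  refine ⟨κ * (4 ^ γ * (2 ^ γ - 1)⁻¹) + η * (1 - 2 ^ (-β₂))⁻¹ + 1, by positivity, ?_⟩
  intro C₁ C₂ Mf K₁ f K₂ hK₁m _ hK₁ hfm hf hK₂m hK₂s hK₂ hK₂L x z hxz
  have hD := pdist_pos hxz
  set D := pdist x z with hD_def
  have hC₁ : 0 ≤ C₁ :=
    nonneg_of_mul_nonneg_left ((abs_nonneg _).trans (hK₁ x z hxz)) (by positivity)
  have hMf : 0 ≤ Mf := (abs_nonneg _).trans (hf x)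
  have hC₂ : 0 ≤ C₂ :=
    nonneg_of_mul_nonneg_left ((abs_nonneg _).trans (hK₂ 0 x z)) (by positivity)
  have hscale : ∀ (n : ℕ) (e : ℝ), (2 : ℝ) ^ ((n : ℝ) * e) = ((2 : ℝ) ^ n) ^ e := fun n e =>
    Real.rpow_natCast_mul (by norm_num) n e
  have hradius : ∀ n : ℕ, (2 : ℝ) ^ (-(n : ℝ)) = ((2 : ℝ) ^ n)⁻¹ := fun n => by
    rw [Real.rpow_neg (by norm_num), Real.rpow_natCast]
  simp only [hscale] at hK₂ hK₂L
  simp only [hradius] at hK₂s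
  have huniform : ∀ n : ℕ, ∫⁻ y, ‖K₁ x y * f y * (K₂ n y z - K₂ n x z)‖ₑ ≤
      ENNReal.ofReal (C₁ * C₂ * Mf * D ^ (-γ) * (κ * (2 ^ n * D) ^ γ)) := by
    intro n
    have hT : (0 : ℝ) < 2 ^ n := by positivity
    refine (lintegral_renormalised_le (r := ((2 : ℝ) ^ n)⁻¹) (G := fun y => K₂ n y z) hc hvol
      hC₁ hMf (by positivity) (by positivity) (by positivity) hb2 hβL hL2 (hK₁ x) hf
      (fun y => hK₂ n y z) (fun y => hK₂L n x y z)).trans_eq ?_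
    congr 1
    generalize (2 : ℝ) ^ n = T at hT
    have e1 : T ^ (s - β₂ + L') * (T⁻¹) ^ (β₁ + L') = T ^ γ := by
      rw [Real.inv_rpow hT.le, ← Real.rpow_neg hT.le, ← Real.rpow_add hT]
      congr 1; ring
    have e2 : T ^ (s - β₂) * (T⁻¹) ^ β₁ = T ^ γ := by
      rw [Real.inv_rpow hT.le, ← Real.rpow_neg hT.le, ← Real.rpow_add hT]
      congr 1; ring
    have e3 : D ^ (-γ) * (T * D) ^ γ = T ^ γ := by
      rw [Real.mul_rpow hT.le hD.le, mul_left_comm, ← Real.rpow_add hD, neg_add_cancel,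
        Real.rpow_zero, mul_one]
    rw [hκ_def]
    linear_combination
      C₁ * Mf * C₂ * c * 2 ^ s * (1 - (1 / 2) ^ (β₁ + L'))⁻¹ * e1 +
      2 * C₁ * Mf * C₂ * c * 2 ^ s * (1 - 2 ^ β₁)⁻¹ * e2 -
      C₁ * Mf * C₂ * (c * 2 ^ s * ((1 - (1 / 2) ^ (β₁ + L'))⁻¹ + 2 * (1 - 2 ^ β₁)⁻¹)) * e3
  have hseparated : ∀ n : ℕ, 2 < 2 ^ n * D →
      ∫⁻ y, ‖K₁ x y * f y * (K₂ n y z - K₂ n x z)‖ₑ ≤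
        ENNReal.ofReal (C₁ * C₂ * Mf * D ^ (-γ) * (η * (2 ^ n * D) ^ (-β₂))) := by
    intro n hn
    have hT : (0 : ℝ) < 2 ^ n := by positivity
    refine (lintegral_renormalised_le_of_separated (r := ((2 : ℝ) ^ n)⁻¹)
      (G := fun y => K₂ n y z) hvol hC₁ hMf (by positivity) (by positivity) hb2 (hK₁ x) hf
      (fun y => hK₂ n y z) (fun y => hK₂s n y z)
      (by rwa [← div_eq_mul_inv, div_lt_iff₀' hT])).trans_eq ?_
    congr 1
    rw [← hD_def, ← hs]
    generalize (2 : ℝ) ^ n = T at hT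
    have e1 : T ^ (s - β₂) * (T⁻¹) ^ s = T ^ (-β₂) := by
      rw [Real.inv_rpow hT.le, ← Real.rpow_neg hT.le, ← Real.rpow_add hT]
      congr 1; ring
    have e2 : (D / 2) ^ (β₁ - s) = D ^ (β₁ - s) * 2 ^ (s - β₁) := by
      rw [Real.div_rpow hD.le (by norm_num), div_eq_mul_inv, ← Real.rpow_neg (by norm_num),
        neg_sub]
    have e3 : D ^ (-γ) * (T * D) ^ (-β₂) = T ^ (-β₂) * D ^ (β₁ - s) := by
      rw [Real.mul_rpow hT.le hD.le, mul_left_comm, ← Real.rpow_add hD]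
      congr 2; ring
    rw [e2, hη_def]
    linear_combination
      C₁ * Mf * C₂ * c * 2 ^ (s - β₁) * D ^ (β₁ - s) * e1 -
      C₁ * Mf * C₂ * c * 2 ^ (s - β₁) * e3
  refine ⟨fun n => ⟨?_, ?_⟩, fun N => ?_⟩
  · have m1 : Measurable fun y => K₁ x y := hK₁m.comp measurable_prodMk_left
    have m2 : Measurable fun y => K₂ n y z := (hK₂m n).comp measurable_prodMk_right
    exact ((m1.mul hfm).mul (m2.sub_const _)).aestronglyMeasurable
  · exact (huniform n).trans_lt ENNReal.ofReal_lt_top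
  · have hterm : ∀ n : ℕ, |∫ y : Pt d, K₁ x y * f y * (K₂ n y z - K₂ n x z)| ≤
        C₁ * C₂ * Mf * D ^ (-γ) * (κ * (if 2 ^ n * D ≤ 2 then (2 ^ n * D) ^ γ else 0) +
          η * (if 2 ^ n * D ≤ 2 then 0 else (2 ^ n * D) ^ (-β₂))) := by
      intro n
      split_ifs with hn
      · rw [mul_zero, add_zero]
        exact abs_integral_le_of_lintegral_enorm_le (by positivity) (huniform n)
      · rw [mul_zero, zero_add]
        exact abs_integral_le_of_lintegral_enorm_le (by positivity)
          (hseparated n (not_le.1 hn))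
    rw [show β₁ + β₂ - s = -γ by ring]
    calc _ ≤ _ := Finset.sum_le_sum fun n _ => hterm n
      _ ≤ C₁ * C₂ * Mf * D ^ (-γ) *
          (κ * (4 ^ γ * (2 ^ γ - 1)⁻¹) + η * (1 - 2 ^ (-β₂))⁻¹ + 1) := by
        rw [← Finset.mul_sum, Finset.sum_add_distrib, ← Finset.mul_sum, ← Finset.mul_sum]
        refine mul_le_mul_of_nonneg_left ?_ (by positivity)
        have t1 := mul_le_mul_of_nonneg_left (sum_ite_le_two_rpow_le hγ hD N) hκ
        have t2 := mul_le_mul_of_nonneg_left (sum_ite_two_lt_rpow_neg_le hb3 N hD) hη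
        linarith
      _ = _ := by ring
end
end
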